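/- arXiv:2103.13596 — 11 statements merged into one kernel-verified Lean document; each statement's English description precedes it below -/
import Mathlib

section
/- A finite simple graph is threshold if and only if it does not contain an induced subgraph isomorphic to 2K_2, P_4, or C_4. -/
/-- A finite simple graph is threshold if every induced subgraph on a nonempty vertex
subset contains a vertex that is either isolated or dominating in that subgraph. -/
def IsThreshold {V : Type} (G : SimpleGraph V) : Prop :=
  ∀ W : Set V, W.Nonempty → ∃ x ∈ W,
    ({y ∈ W | G.Adj x y} = (∅ : Set V)) ∨ ({y ∈ W | G.Adj x y} = W \ {x})

/-- The graph `2K₂`: four vertices with exactly the edges `{0,1}` and `{2,3}`. -/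
def twoK2 : SimpleGraph (Fin 4) := SimpleGraph.fromEdgeSet {s(0, 1), s(2, 3)}

/-- The path `P₄`: four vertices with exactly the edges `{0,1}`, `{1,2}`, `{2,3}`. -/
def pathP4 : SimpleGraph (Fin 4) := SimpleGraph.fromEdgeSet {s(0, 1), s(1, 2), s(2, 3)}

/-- The cycle `C₄`: four vertices with exactly the edges `{0,1}`, `{1,2}`, `{2,3}`, `{3,0}`. -/
def cycleC4 : SimpleGraph (Fin 4) :=
  SimpleGraph.fromEdgeSet {s(0, 1), s(1, 2), s(2, 3), s(3, 0)}

/-- A quadruple of vertices with edges `ab`, `cd` and non-edges `ac`, `bd`. -/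
def IsAlternatingFourCycle {V : Type} (G : SimpleGraph V) (a b c d : V) : Prop :=
  G.Adj a b ∧ G.Adj c d ∧ ¬ G.Adj a c ∧ ¬ G.Adj b d ∧ a ≠ c ∧ b ≠ d

theorem IsThreshold.not_isAlternatingFourCycle {V : Type} {G : SimpleGraph V}
    (h : IsThreshold G) (a b c d : V) : ¬ IsAlternatingFourCycle G a b c d := by
  rintro ⟨hab, hcd, hac, hbd, hne, hne'⟩
  obtain ⟨x, hx, hx' | hx'⟩ := h {a, b, c, d} ⟨a, by simp⟩
  · simp only [Set.ext_iff, Set.mem_ofPred_eq, Set.mem_empty_iff_false, iff_false] at hx'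
    rcases hx with rfl | rfl | rfl | rfl
    · exact hx' b ⟨by simp, hab⟩
    · exact hx' a ⟨by simp, hab.symm⟩
    · exact hx' d ⟨by simp, hcd⟩
    · exact hx' c ⟨by simp, hcd.symm⟩
  · simp only [Set.ext_iff, Set.mem_ofPred_eq, Set.mem_sdiff, Set.mem_singleton_iff] at hx'
    rcases hx with rfl | rfl | rfl | rfl
    · exact hac ((hx' c).2 ⟨by simp, hne.symm⟩).2
    · exact hbd ((hx' d).2 ⟨by simp, hne'.symm⟩).2
    · exact hac ((hx' a).2 ⟨by simp, hne⟩).2.symm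
    · exact hbd ((hx' b).2 ⟨by simp, hne'⟩).2.symm

theorem isThreshold_of_forall_not_isAlternatingFourCycle {V : Type} [Finite V]
    {G : SimpleGraph V} (h : ∀ a b c d, ¬ IsAlternatingFourCycle G a b c d) :
    IsThreshold G := by
  intro W hW
  obtain ⟨x, hxW, hmax⟩ :=
    Set.exists_max_image W (fun v => {y ∈ W | G.Adj v y}.ncard) W.toFinite hW
  by_cases hdom : {y ∈ W | G.Adj x y} = W \ {x}
  · exact ⟨x, hxW, Or.inr hdom⟩
  obtain ⟨z, hzW, hzx, hxz⟩ : ∃ z ∈ W, z ≠ x ∧ ¬ G.Adj x z := by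
    by_contra! hcon
    refine hdom (Set.ext fun y => ⟨fun hy => ⟨hy.1, hy.2.ne'⟩, fun hy => ⟨hy.1, ?_⟩⟩)
    exact hcon y hy.1 hy.2
  refine ⟨z, hzW, Or.inl (Set.eq_empty_of_forall_notMem ?_)⟩
  rintro w ⟨hwW, hzw⟩
  have hsub : {y ∈ W | G.Adj x y} \ {w} ⊂ {y ∈ W | G.Adj w y} \ {x} := by
    refine ⟨?_, fun hle => hxz (hle ⟨⟨hzW, hzw.symm⟩, hzx⟩).1.2⟩
    rintro u ⟨⟨huW, hxu⟩, huw⟩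
    refine ⟨⟨huW, ?_⟩, hxu.ne'⟩
    by_contra hwu
    exact h x u z w ⟨hxu, hzw, hxz, fun huw' => hwu huw'.symm, hzx.symm, huw⟩
  have hlt := Set.ncard_lt_ncard hsub (Set.toFinite _)
  have hle := hmax w hwW
  by_cases hxw : G.Adj x w
  · have h₁ := Set.ncard_sdiff_singleton_add_one
      (show w ∈ {y ∈ W | G.Adj x y} from ⟨hwW, hxw⟩) (Set.toFinite _)
    have h₂ := Set.ncard_sdiff_singleton_add_one
      (show x ∈ {y ∈ W | G.Adj w y} from ⟨hxW, hxw.symm⟩) (Set.toFinite _)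
    omega
  · rw [Set.sdiff_singleton_eq_self fun hw => hxw hw.2,
      Set.sdiff_singleton_eq_self fun hx => hxw hx.2.symm] at hlt
    omega

theorem isAlternatingFourCycle_of_iso {V : Type} {G : SimpleGraph V} {W : Set V}
    {H : SimpleGraph (Fin 4)} (e : G.induce W ≃g H) (hH : IsAlternatingFourCycle H 0 1 2 3) :
    IsAlternatingFourCycle G (e.symm 0) (e.symm 1) (e.symm 2) (e.symm 3) := by
  obtain ⟨h₁, h₂, h₃, h₄, -, -⟩ := hH
  have hne : ∀ i j : Fin 4, i ≠ j → (e.symm i : V) ≠ e.symm j := fun i j hij heq =>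
    hij (e.symm.injective (Subtype.ext heq))
  exact ⟨e.symm.map_adj_iff.2 h₁, e.symm.map_adj_iff.2 h₂, fun h => h₃ (e.symm.map_adj_iff.1 h),
    fun h => h₄ (e.symm.map_adj_iff.1 h), hne _ _ (by decide), hne _ _ (by decide)⟩

theorem nonempty_induce_range_iso {V ι : Type} {G : SimpleGraph V} {H : SimpleGraph ι}
    (f : ι → V) (hf : Function.Injective f) (hadj : ∀ i j, G.Adj (f i) (f j) ↔ H.Adj i j) :
    Nonempty (G.induce (Set.range f) ≃g H) :=
  ⟨RelIso.symm ⟨Equiv.ofInjective f hf, fun {i j} => hadj i j⟩⟩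

theorem IsAlternatingFourCycle.exists_iso {V : Type} {G : SimpleGraph V} {a b c d : V}
    (h : IsAlternatingFourCycle G a b c d) :
    ∃ W : Set V, Nonempty (G.induce W ≃g twoK2) ∨ Nonempty (G.induce W ≃g pathP4) ∨
      Nonempty (G.induce W ≃g cycleC4) := by
  obtain ⟨hab, hcd, hac, hbd, hne, hne'⟩ := h
  have had : a ≠ d := by rintro rfl; exact hac hcd.symm
  have hbc : b ≠ c := by rintro rfl; exact hac hab
  have hinj : Function.Injective ![a, b, c, d] := by
    intro i j
    fin_cases i <;> fin_cases j <;> simp [hab.ne, hab.ne', hcd.ne, hcd.ne', hne, hne.symm,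
      hne', hne'.symm, had, had.symm, hbc, hbc.symm]
  have hinj' : Function.Injective ![b, a, d, c] := by
    intro i j
    fin_cases i <;> fin_cases j <;> simp [hab.ne, hab.ne', hcd.ne, hcd.ne', hne, hne.symm,
      hne', hne'.symm, had, had.symm, hbc, hbc.symm]
  by_cases h₁ : G.Adj a d <;> by_cases h₂ : G.Adj b c
  · refine ⟨_, Or.inr (Or.inr (nonempty_induce_range_iso _ hinj fun i j => ?_))⟩
    fin_cases i <;> fin_cases j <;>
      simp [cycleC4, hab, hab.symm, hcd, hcd.symm, hac, hbd, h₁, h₁.symm, h₂, h₂.symm,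
        G.adj_comm c a, G.adj_comm d b]
  · refine ⟨_, Or.inr (Or.inl (nonempty_induce_range_iso _ hinj' fun i j => ?_))⟩
    fin_cases i <;> fin_cases j <;>
      simp [pathP4, hab, hab.symm, hcd, hcd.symm, hac, hbd, h₁, h₁.symm, h₂,
        G.adj_comm c a, G.adj_comm d b, G.adj_comm c b]
  · refine ⟨_, Or.inr (Or.inl (nonempty_induce_range_iso _ hinj fun i j => ?_))⟩
    fin_cases i <;> fin_cases j <;>
      simp [pathP4, hab, hab.symm, hcd, hcd.symm, hac, hbd, h₁, h₂, h₂.symm,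
        G.adj_comm c a, G.adj_comm d b, G.adj_comm d a]
  · refine ⟨_, Or.inl (nonempty_induce_range_iso _ hinj fun i j => ?_)⟩
    fin_cases i <;> fin_cases j <;>
      simp [twoK2, hab, hab.symm, hcd, hcd.symm, hac, hbd, h₁, h₂,
        G.adj_comm c a, G.adj_comm d b, G.adj_comm d a, G.adj_comm c b]

/-- A finite simple graph is threshold iff it has no induced subgraph isomorphic to
`2K₂`, `P₄`, or `C₄`. -/
theorem stmt1 {V : Type} [Fintype V] (G : SimpleGraph V) :
    IsThreshold G ↔
      ∀ W : Set V,
        IsEmpty ((G.induce W) ≃g twoK2) ∧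
        IsEmpty ((G.induce W) ≃g pathP4) ∧
        IsEmpty ((G.induce W) ≃g cycleC4) := by
  constructor
  · intro h W
    refine ⟨⟨fun e => ?_⟩, ⟨fun e => ?_⟩, ⟨fun e => ?_⟩⟩
    · exact h.not_isAlternatingFourCycle _ _ _ _
        (isAlternatingFourCycle_of_iso e (by simp [IsAlternatingFourCycle, twoK2]))
    · exact h.not_isAlternatingFourCycle _ _ _ _
        (isAlternatingFourCycle_of_iso e (by simp [IsAlternatingFourCycle, pathP4]))
    · exact h.not_isAlternatingFourCycle _ _ _ _
        (isAlternatingFourCycle_of_iso e (by simp [IsAlternatingFourCycle, cycleC4]))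
  · refine fun h => isThreshold_of_forall_not_isAlternatingFourCycle fun a b c d hc => ?_
    obtain ⟨W, hW⟩ := hc.exists_iso
    obtain ⟨h₁, h₂, h₃⟩ := h W
    rcases hW with ⟨⟨e⟩⟩ | ⟨⟨e⟩⟩ | ⟨⟨e⟩⟩
    · exact h₁.false e
    · exact h₂.false e
    · exact h₃.false e
end

section
/- A connected bipartite finite simple graph on at least two vertices is Ferrers if and only if it does not contain an induced subgraph isomorphic to 2K_2. -/
/-- A finite simple graph is Ferrers if its vertex set can be partitioned into two
nonempty ordered parts `r 0, …, r (m-1)` and `c 0, …, c (n-1)` such that every edge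
joins an `r`-vertex to a `c`-vertex, `{r 0, c (n-1)}` and `{r (m-1), c 0}` are edges,
and edges are downward closed in both indices. -/
def IsFerrers {V : Type} (G : SimpleGraph V) : Prop :=
  ∃ (m n : ℕ) (hm : 0 < m) (hn : 0 < n) (r : Fin m → V) (c : Fin n → V),
    Function.Injective r ∧ Function.Injective c ∧
    (∀ i j, r i ≠ c j) ∧
    (∀ x : V, (∃ i, x = r i) ∨ (∃ j, x = c j)) ∧
    (∀ x y : V, G.Adj x y →
      ((∃ i j, x = r i ∧ y = c j) ∨ (∃ i j, x = c i ∧ y = r j))) ∧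
    G.Adj (r ⟨0, hm⟩) (c ⟨n - 1, Nat.sub_lt hn Nat.one_pos⟩) ∧
    G.Adj (r ⟨m - 1, Nat.sub_lt hm Nat.one_pos⟩) (c ⟨0, hn⟩) ∧
    (∀ (k : Fin m) (l : Fin n), G.Adj (r k) (c l) →
      ∀ (i : Fin m) (j : Fin n), i ≤ k → j ≤ l → G.Adj (r i) (c j))

/-- A graph is bipartite if its vertex set can be partitioned into two parts such that
every edge joins vertices in different parts. -/
def IsBipartite {V : Type} (G : SimpleGraph V) : Prop :=
  ∃ S : Set V, ∀ x y : V, G.Adj x y → (x ∈ S ↔ y ∉ S)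

theorem twoK2_adj_iff (i j : Fin 4) :
    twoK2.Adj i j ↔ (i = 0 ∧ j = 1) ∨ (i = 1 ∧ j = 0) ∨ (i = 2 ∧ j = 3) ∨ (i = 3 ∧ j = 2) := by
  simp only [twoK2, SimpleGraph.fromEdgeSet_adj, Set.mem_insert_iff, Set.mem_singleton_iff,
    Sym2.eq_iff]
  revert i j
  decide

/-- No induced subgraph is isomorphic to `2K₂` iff any two edges share an endpoint or are
joined by an edge. -/
theorem forall_isEmpty_induce_iso_twoK2_iff {V : Type} (G : SimpleGraph V) :
    (∀ W : Set V, IsEmpty ((G.induce W) ≃g twoK2)) ↔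
      ∀ a b c d : V, G.Adj a b → G.Adj c d →
        a = c ∨ a = d ∨ b = c ∨ b = d ∨ G.Adj a c ∨ G.Adj a d ∨ G.Adj b c ∨ G.Adj b d := by
  constructor
  · intro h a b c d hab hcd
    by_contra! hne
    obtain ⟨hac, had, hbc, hbd, nac, nad, nbc, nbd⟩ := hne
    let f : Fin 4 → V := ![a, b, c, d]
    have hab' := hab.ne
    have hcd' := hcd.ne
    have hf : Function.Injective f := by
      intro i j hij
      fin_cases i <;> fin_cases j <;> simp_all [f, eq_comm]
    have hadj : ∀ i j, G.Adj (f i) (f j) ↔ twoK2.Adj i j := by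
      intro i j
      rw [twoK2_adj_iff]
      fin_cases i <;> fin_cases j <;> simp_all [f, G.adj_comm]
    refine (h (Set.range f)).false (RelIso.symm ⟨Equiv.ofInjective f hf, ?_⟩)
    intro i j
    simpa using hadj i j
  · refine fun h W => ⟨fun φ => ?_⟩
    have hadj : ∀ i j, G.Adj (φ.symm i) (φ.symm j) ↔ twoK2.Adj i j := fun i j =>
      φ.symm.map_rel_iff
    have hinj : ∀ i j, (φ.symm i : V) = φ.symm j ↔ i = j := fun i j =>
      Subtype.coe_injective.eq_iff.trans φ.symm.injective.eq_iff
    have := h (φ.symm 0) (φ.symm 1) (φ.symm 2) (φ.symm 3)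
    simp [hadj, hinj, twoK2_adj_iff] at this

theorem IsFerrers.adj_of_adj_of_adj {V : Type} {G : SimpleGraph V} (hG : IsFerrers G)
    {a b c d : V} (hab : G.Adj a b) (hcd : G.Adj c d) :
    G.Adj a c ∨ G.Adj a d ∨ G.Adj b c ∨ G.Adj b d := by
  obtain ⟨m, n, -, -, r, s, -, -, -, -, hedge, -, -, hdown⟩ := hG
  have key : ∀ i j k l, G.Adj (r i) (s j) → G.Adj (r k) (s l) →
      G.Adj (r i) (s l) ∨ G.Adj (r k) (s j) := fun i j k l hij hkl =>
    (le_total i k).imp (fun h => hdown k l hkl i l h le_rfl)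
      (fun h => hdown i j hij k j h le_rfl)
  rcases hedge a b hab with ⟨i, j, rfl, rfl⟩ | ⟨j, i, rfl, rfl⟩ <;>
  rcases hedge c d hcd with ⟨k, l, rfl, rfl⟩ | ⟨l, k, rfl, rfl⟩ <;>
  grind [G.adj_comm]

/-- A finite set can be enumerated without repetition so that a given function is antitone. -/
theorem exists_injective_range_eq_antitone {V : Type} [Finite V] (A : Set V) (f : V → ℕ) :
    ∃ r : Fin (Nat.card A) → V, Function.Injective r ∧ Set.range r = A ∧ Antitone (f ∘ r) := by
  let e : Fin (Nat.card A) ≃ A := (Finite.equivFin A).symm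
  let g : Fin (Nat.card A) → ℕᵒᵈ := fun i => OrderDual.toDual (f (e i))
  refine ⟨fun i => e (Tuple.sort g i), ?_, ?_, fun i j hij => Tuple.monotone_sort g hij⟩
  · exact Subtype.coe_injective.comp (e.injective.comp (Tuple.sort g).injective)
  · ext x
    constructor
    · rintro ⟨i, rfl⟩
      exact (e _).2
    · exact fun hx => ⟨((Tuple.sort g).trans e).symm ⟨x, hx⟩,
        congrArg Subtype.val (((Tuple.sort g).trans e).apply_symm_apply ⟨x, hx⟩)⟩

theorem neighborSet_subset_of_ncard_le {V : Type} [Finite V] {G : SimpleGraph V} {S : Set V}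
    (hS : ∀ x y : V, G.Adj x y → (x ∈ S ↔ y ∉ S))
    (hG : ∀ a b c d : V, G.Adj a b → G.Adj c d →
      a = c ∨ a = d ∨ b = c ∨ b = d ∨ G.Adj a c ∨ G.Adj a d ∨ G.Adj b c ∨ G.Adj b d)
    {x y : V} (hxy : x ∈ S ↔ y ∈ S) (hle : (G.neighborSet x).ncard ≤ (G.neighborSet y).ncard) :
    G.neighborSet x ⊆ G.neighborSet y := by
  intro u hu
  by_contra hu'
  have hnot : ¬ G.neighborSet y ⊆ G.neighborSet x := fun hsub =>
    hu' (Set.eq_of_subset_of_ncard_le hsub hle (Set.toFinite _) ▸ hu)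
  obtain ⟨v, hv, hv'⟩ := Set.not_subset.mp hnot
  rw [SimpleGraph.mem_neighborSet] at hu hu' hv hv'
  have := hG x u y v hu hv
  grind [G.adj_comm]

theorem isFerrers_of_forall_adj {V : Type} [Finite V] [Nonempty V] {G : SimpleGraph V}
    (hbip : IsBipartite G) (hnbr : ∀ x, ∃ y, G.Adj x y)
    (hG : ∀ a b c d : V, G.Adj a b → G.Adj c d →
      a = c ∨ a = d ∨ b = c ∨ b = d ∨ G.Adj a c ∨ G.Adj a d ∨ G.Adj b c ∨ G.Adj b d) :
    IsFerrers G := by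
  obtain ⟨S, hS⟩ := hbip
  obtain ⟨r, hr, hrS, hranti⟩ :=
    exists_injective_range_eq_antitone S fun x => (G.neighborSet x).ncard
  obtain ⟨c, hc, hcS, hcanti⟩ :=
    exists_injective_range_eq_antitone Sᶜ fun x => (G.neighborSet x).ncard
  have hrmem : ∀ i, r i ∈ S := fun i => hrS ▸ Set.mem_range_self i
  have hcmem : ∀ j, c j ∉ S := fun j => (hcS ▸ Set.mem_range_self j : c j ∈ Sᶜ)
  have hrex : ∀ x ∈ S, ∃ i, x = r i := fun x hx => by
    obtain ⟨i, hi⟩ := hrS.symm ▸ hx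
    exact ⟨i, hi.symm⟩
  have hcex : ∀ x ∉ S, ∃ j, x = c j := fun x hx => by
    obtain ⟨j, hj⟩ : x ∈ Set.range c := hcS.symm ▸ hx
    exact ⟨j, hj.symm⟩
  have hrmono : ∀ i k y, i ≤ k → G.Adj (r k) y → G.Adj (r i) y := fun i k y hik h =>
    neighborSet_subset_of_ncard_le hS hG (by simp [hrmem]) (hranti hik) h
  have hcmono : ∀ j l y, j ≤ l → G.Adj (c l) y → G.Adj (c j) y := fun j l y hjl h =>
    neighborSet_subset_of_ncard_le hS hG (by simp [hcmem]) (hcanti hjl) h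
  have hrnbr : ∀ i, ∃ j, G.Adj (r i) (c j) := fun i => by
    obtain ⟨y, hy⟩ := hnbr (r i)
    obtain ⟨j, rfl⟩ := hcex y ((hS _ _ hy).mp (hrmem i))
    exact ⟨j, hy⟩
  have hcnbr : ∀ j, ∃ i, G.Adj (c j) (r i) := fun j => by
    obtain ⟨y, hy⟩ := hnbr (c j)
    obtain ⟨i, rfl⟩ := hrex y ((hS _ _ hy.symm).mpr (hcmem j))
    exact ⟨i, hy⟩
  have hpos : 0 < Nat.card S ∧ 0 < Nat.card (Sᶜ : Set V) := by
    obtain ⟨x⟩ := ‹Nonempty V›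
    by_cases hx : x ∈ S
    · obtain ⟨i, rfl⟩ := hrex x hx
      obtain ⟨j, -⟩ := hrnbr i
      exact ⟨i.pos, j.pos⟩
    · obtain ⟨j, rfl⟩ := hcex x hx
      obtain ⟨i, -⟩ := hcnbr j
      exact ⟨i.pos, j.pos⟩
  refine ⟨_, _, hpos.1, hpos.2, r, c, hr, hc, fun i j h => hcmem j (h ▸ hrmem i), fun x => ?_,
    fun x y hxy => ?_, ?_, ?_, fun k l hkl i j hik hjl => ?_⟩
  · exact (em (x ∈ S)).imp (hrex x) (hcex x)
  · by_cases hx : x ∈ S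
    · obtain ⟨i, rfl⟩ := hrex x hx
      obtain ⟨j, rfl⟩ := hcex y ((hS _ _ hxy).mp hx)
      exact Or.inl ⟨i, j, rfl, rfl⟩
    · obtain ⟨j, rfl⟩ := hcex x hx
      obtain ⟨i, rfl⟩ := hrex y ((hS _ _ hxy.symm).mpr hx)
      exact Or.inr ⟨j, i, rfl, rfl⟩
  · obtain ⟨i, hi⟩ := hcnbr ⟨_, Nat.sub_lt hpos.2 Nat.one_pos⟩
    exact hrmono _ i _ (Nat.zero_le _) hi.symm
  · obtain ⟨j, hj⟩ := hrnbr ⟨_, Nat.sub_lt hpos.1 Nat.one_pos⟩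
    exact (hcmono _ j _ (Nat.zero_le _) hj.symm).symm
  · exact hrmono i k _ hik (hcmono j l _ hjl hkl.symm).symm

/-- A connected bipartite finite simple graph on at least two vertices is Ferrers iff
it contains no induced subgraph isomorphic to `2K₂`. -/
theorem stmt2 {V : Type} [Fintype V] (G : SimpleGraph V)
    (hconn : G.Connected) (hbip : IsBipartite G) (hcard : 2 ≤ Fintype.card V) :
    IsFerrers G ↔ ∀ W : Set V, IsEmpty ((G.induce W) ≃g twoK2) := by
  rw [forall_isEmpty_induce_iso_twoK2_iff]
  have := hconn.nonempty
  refine ⟨fun h a b c d hab hcd => ?_, isFerrers_of_forall_adj hbip fun x => ?_⟩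
  · have := h.adj_of_adj_of_adj hab hcd
    tauto
  · have : Nontrivial V := Fintype.one_lt_card_iff_nontrivial.mp hcard
    exact hconn.preconnected.exists_adj_of_nontrivial x
end

section
/- Every Ferrers graph is special 2-threshold; more precisely, if G is a Ferrers graph with bipartition R ⊔ C as in the definition, then G is C-threshold. -/
/-- `G` is `U`-threshold if every induced subgraph on a nonempty vertex subset `W` has a
vertex `x` whose neighborhood within `W` is empty or equals `(W \ {x}) ∩ U`. -/
def IsUThreshold {V : Type} (G : SimpleGraph V) (U : Set V) : Prop :=
  ∀ W : Set V, W.Nonempty → ∃ x ∈ W,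
    ({y ∈ W | G.Adj x y} = (∅ : Set V)) ∨ ({y ∈ W | G.Adj x y} = (W \ {x}) ∩ U)

/-- Every Ferrers graph, with bipartition `R ⊔ C` as in the definition, is `C`-threshold
(hence special 2-threshold). -/
theorem stmt3 {V : Type} (G : SimpleGraph V)
    (m n : ℕ) (hm : 0 < m) (hn : 0 < n) (r : Fin m → V) (c : Fin n → V)
    (hr : Function.Injective r) (hc : Function.Injective c)
    (hrc : ∀ i j, r i ≠ c j)
    (hcover : ∀ x : V, (∃ i, x = r i) ∨ (∃ j, x = c j))
    (hedges : ∀ x y : V, G.Adj x y →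
      ((∃ i j, x = r i ∧ y = c j) ∨ (∃ i j, x = c i ∧ y = r j)))
    (hcorner₁ : G.Adj (r ⟨0, hm⟩) (c ⟨n - 1, Nat.sub_lt hn Nat.one_pos⟩))
    (hcorner₂ : G.Adj (r ⟨m - 1, Nat.sub_lt hm Nat.one_pos⟩) (c ⟨0, hn⟩))
    (hmono : ∀ (k : Fin m) (l : Fin n), G.Adj (r k) (c l) →
      ∀ (i : Fin m) (j : Fin n), i ≤ k → j ≤ l → G.Adj (r i) (c j)) :
    IsUThreshold G (Set.range c) := by
  intro W ⟨x, hx⟩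
  by_cases hC : ∃ j, c j ∈ W
  · obtain ⟨j, hj, hmax⟩ := Set.exists_max_image {j | c j ∈ W} id (Set.toFinite _) hC
    by_cases hR : ∃ i, r i ∈ W ∧ G.Adj (r i) (c j)
    · obtain ⟨i, hi, hij⟩ := hR
      refine ⟨r i, hi, Or.inr ?_⟩
      ext y
      constructor
      · rintro ⟨hy, hadj⟩
        refine ⟨⟨hy, fun h => G.ne_of_adj hadj h.symm⟩, ?_⟩
        rcases hedges _ _ hadj with ⟨_, l, _, rfl⟩ | ⟨k, _, hk, _⟩
        · exact ⟨l, rfl⟩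
        · exact absurd hk (hrc i k)
      · rintro ⟨⟨hy, _⟩, l, rfl⟩
        exact ⟨hy, hmono i j hij i l le_rfl (hmax l hy)⟩
    · refine ⟨c j, hj, Or.inl (Set.eq_empty_iff_forall_notMem.2 ?_)⟩
      rintro y ⟨hy, hadj⟩
      rcases hedges _ _ hadj with ⟨i, _, hi, _⟩ | ⟨_, k, _, rfl⟩
      · exact hrc i j hi.symm
      · exact hR ⟨k, hy, hadj.symm⟩
  · refine ⟨x, hx, Or.inl (Set.eq_empty_iff_forall_notMem.2 ?_)⟩
    rintro y ⟨hy, hadj⟩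
    rcases hedges _ _ hadj with ⟨_, l, _, rfl⟩ | ⟨k, _, rfl, _⟩
    · exact hC ⟨l, hy⟩
    · exact hC ⟨k, hx⟩
end

section
/- For positive integers m and n, the number of spanning trees of the complete bipartite graph K_{m,n} is τ(K_{m,n}) = m^(n−1) · n^(m−1). -/
/-- The number of spanning trees of a finite simple graph `G`. -/
noncomputable def tau {V : Type} [Fintype V] (G : SimpleGraph V) : ℕ :=
  Nat.card {H : SimpleGraph V // H ≤ G ∧ H.IsTree}

open Finset Matrix

/-- `f` assigns to each vertex of a spanning tree of `G` rooted at `r` its parent, and `r` to `r`. -/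
structure IsParentMap {V : Type*} (G : SimpleGraph V) (r : V) (f : V → V) : Prop where
  map_root : f r = r
  adj : ∀ v, v ≠ r → G.Adj v (f v)
  exists_iterate : ∀ v, ∃ k, f^[k] v = r

namespace IsParentMap

variable {V : Type*} {G : SimpleGraph V} {r : V} {f g : V → V}

lemma reachable (hf : IsParentMap G r f) (k : ℕ) (v : V) (h : f^[k] v = r) :
    (SimpleGraph.fromRel fun u w => f u = w).Reachable v r := by
  induction k generalizing v with
  | zero => obtain rfl : v = r := h; rfl
  | succ k ih =>
    by_cases hv : v = f v
    · apply ih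
      rw [Function.iterate_succ_apply, ← hv] at h
      exact h
    · refine (SimpleGraph.Adj.reachable ?_).trans (ih (f v) h)
      exact (SimpleGraph.fromRel_adj _ _ _).2 ⟨hv, Or.inl rfl⟩

lemma fromRel_le (hf : IsParentMap G r f) : (SimpleGraph.fromRel fun u w => f u = w) ≤ G := by
  have key : ∀ u, u ≠ f u → G.Adj u (f u) := fun u hu =>
    hf.adj u (by rintro rfl; exact hu hf.map_root.symm)
  intro u w h
  obtain ⟨hne, rfl | rfl⟩ := (SimpleGraph.fromRel_adj _ _ _).1 h
  · exact key _ hne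
  · exact (key _ hne.symm).symm

lemma isTree_fromRel [Finite V] (hf : IsParentMap G r f) :
    (SimpleGraph.fromRel fun u w => f u = w).IsTree := by
  classical
  have := Fintype.ofFinite V
  set T := SimpleGraph.fromRel fun u w => f u = w with hT
  have hreach : ∀ v, T.Reachable v r := fun v =>
    (hf.exists_iterate v).elim fun k hk => hf.reachable k v hk
  have hconn : T.Connected :=
    { preconnected := fun u v => (hreach u).trans (hreach v).symm
      nonempty := ⟨r⟩ }
  refine SimpleGraph.isTree_iff_connected_and_card.2
    ⟨hconn, le_antisymm ?_ hconn.card_vert_le_card_edgeSet_add_one⟩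
  have hsub : T.edgeFinset ⊆ (univ.erase r).image fun v => s(v, f v) := by
    intro e
    induction e with | _ u w
    rw [SimpleGraph.mem_edgeFinset, SimpleGraph.mem_edgeSet, hT, SimpleGraph.fromRel_adj]
    rintro ⟨hne, rfl | rfl⟩
    · refine mem_image.2 ⟨u, mem_erase.2 ⟨?_, mem_univ _⟩, rfl⟩
      rintro rfl
      exact hne hf.map_root.symm
    · refine mem_image.2 ⟨w, mem_erase.2 ⟨?_, mem_univ _⟩, Sym2.eq_swap⟩
      rintro rfl
      exact hne hf.map_root
  have hcard := (card_le_card hsub).trans card_image_le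
  rw [card_erase_of_mem (mem_univ _), card_univ] at hcard
  have hpos : 0 < Fintype.card V := Fintype.card_pos_iff.2 ⟨r⟩
  rw [Nat.card_eq_fintype_card, Nat.card_eq_fintype_card, ← SimpleGraph.edgeFinset_card]
  omega

lemma eq_of_fromRel_eq (hf : IsParentMap G r f) (hg : IsParentMap G r g)
    (h : (SimpleGraph.fromRel fun u w => f u = w) = SimpleGraph.fromRel fun u w => g u = w) :
    f = g := by
  have key : ∀ k v, f^[k] v = r → f v = g v := by
    intro k
    induction k with
    | zero =>
      rintro v rfl
      exact hf.map_root.trans hg.map_root.symm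
    | succ k ih =>
      intro v hv
      by_cases hvr : v = r
      · subst hvr
        exact hf.map_root.trans hg.map_root.symm
      have hadj : (SimpleGraph.fromRel fun u w => g u = w).Adj v (f v) := by
        rw [← h, SimpleGraph.fromRel_adj]
        exact ⟨(hf.adj v hvr).ne, Or.inl rfl⟩
      obtain ⟨-, h1 | h1⟩ := (SimpleGraph.fromRel_adj _ _ _).1 hadj
      · exact h1.symm
      · have h2 : f (f v) = v := (ih (f v) hv).trans h1
        have h3 : ∀ j, f^[j] v = v ∨ f^[j] v = f v := by
          intro j
          induction j with
          | zero => exact Or.inl rfl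
          | succ j ihj =>
            rw [Function.iterate_succ_apply']
            rcases ihj with e | e <;> rw [e]
            · exact Or.inr rfl
            · exact Or.inl h2
        rcases h3 (k + 1) with e | e
        · exact absurd (e.symm.trans hv) hvr
        · rw [e.symm.trans hv, hf.map_root] at h2
          exact absurd h2.symm hvr
  funext v
  obtain ⟨k, hk⟩ := hf.exists_iterate v
  exact key k v hk

end IsParentMap

lemma SimpleGraph.Connected.exists_adj_dist_lt {V : Type*} {G : SimpleGraph V} (hG : G.Connected)
    {v r : V} (hv : v ≠ r) : ∃ w, G.Adj v w ∧ G.dist w r < G.dist v r := by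
  obtain ⟨p, hp⟩ := hG.exists_walk_length_eq_dist v r
  cases p with
  | nil => exact absurd rfl hv
  | cons h q =>
    refine ⟨_, h, ?_⟩
    rw [← hp, SimpleGraph.Walk.length_cons]
    exact Nat.lt_succ_of_le (SimpleGraph.dist_le q)

lemma SimpleGraph.Connected.exists_isParentMap {V : Type*} {G : SimpleGraph V} (hG : G.Connected)
    (r : V) : ∃ f, IsParentMap G r f := by
  classical
  choose p hp using fun (v : V) (hv : v ≠ r) => hG.exists_adj_dist_lt hv
  refine ⟨fun v => if h : v = r then r else p v h, by simp, fun v hv => ?_, ?_⟩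
  · simpa [hv] using (hp v hv).1
  · intro v
    induction hd : G.dist v r using Nat.strong_induction_on generalizing v with
    | _ d ih =>
      by_cases hv : v = r
      · exact ⟨0, hv⟩
      · obtain ⟨k, hk⟩ := ih _ (hd ▸ (hp v hv).2) (p v hv) rfl
        refine ⟨k + 1, ?_⟩
        rw [Function.iterate_succ_apply]
        simpa [hv] using hk

lemma SimpleGraph.card_isTree_eq_card_isParentMap {V : Type*} [Finite V] (G : SimpleGraph V)
    (r : V) : Nat.card {H : SimpleGraph V // H ≤ G ∧ H.IsTree} =
      Nat.card {f : V → V // IsParentMap G r f} := by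
  symm
  refine Nat.card_eq_of_bijective
    (fun f => ⟨SimpleGraph.fromRel fun u w => f.1 u = w, f.2.fromRel_le, f.2.isTree_fromRel⟩)
    ⟨fun f g h => Subtype.ext (f.2.eq_of_fromRel_eq g.2 (congrArg Subtype.val h)), ?_⟩
  rintro ⟨H, hle, hH⟩
  obtain ⟨f, hf⟩ := hH.connected.exists_isParentMap r
  refine ⟨⟨f, hf.map_root, fun v hv => hle (hf.adj v hv), hf.exists_iterate⟩, Subtype.ext ?_⟩
  exact le_antisymm hf.fromRel_le
    ((isTree_iff_minimal_connected.1 hH).2 hf.isTree_fromRel.connected hf.fromRel_le)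

lemma Matrix.det_one_sub_of_isNilpotent {n : Type*} [Fintype n] [DecidableEq n]
    {N : Matrix n n ℚ} (hN : IsNilpotent N) : (1 - N).det = 1 := by
  have h := sub_eq_zero.1 (isNilpotent_charpoly_sub_pow_of_isNilpotent hN).eq_zero
  have := congrArg (Polynomial.eval 1) h
  simpa [Matrix.eval_charpoly] using this

/-- The contribution of the edge from `v` to `u` to row `v` of the Laplacian, with row `r` replaced
by that of the identity matrix. -/
def parentRow {V : Type*} [DecidableEq V] (r v u : V) : V → ℚ :=
  if v = r then Pi.single r 1 else Pi.single v 1 - Pi.single u 1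

section

variable {V : Type*} [Fintype V] [DecidableEq V] {r : V} {f : V → V}

lemma parentRow_mulVec (x : V → ℚ) (v : V) :
    ((of fun v => parentRow r v (f v)) *ᵥ x) v = if v = r then x r else x v - x (f v) := by
  rw [mulVec]
  change parentRow r v (f v) ⬝ᵥ x = _
  unfold parentRow
  split_ifs <;> simp [sub_dotProduct]

lemma det_parentRow_of_exists (h : ∀ v, ∃ k, f^[k] v = r) :
    (of fun v => parentRow r v (f v)).det = 1 := by
  set M := of fun v => parentRow r v (f v) with hM
  have hstep : ∀ (x : V → ℚ) v, ((1 - M) *ᵥ x) v = if v = r then 0 else x (f v) := by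
    intro x v
    rw [sub_mulVec, one_mulVec, Pi.sub_apply, hM, parentRow_mulVec]
    split_ifs with hv
    · rw [hv, sub_self]
    · ring
  have hiter : ∀ k v j, j < k → f^[j] v = r → ∀ x : V → ℚ, (((1 - M) ^ k) *ᵥ x) v = 0 := by
    intro k
    induction k with
    | zero => intro v j hj; omega
    | succ k ih =>
      intro v j hj hv x
      rw [pow_succ', ← mulVec_mulVec, hstep]
      split_ifs with hvr
      · rfl
      · cases j with
        | zero => exact absurd hv hvr
        | succ j => exact ih (f v) j (by omega) hv x
  choose d hd using h
  have hnil : IsNilpotent (1 - M) := by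
    refine ⟨univ.sup d + 1, ?_⟩
    refine Matrix.ext_of_mulVec_single fun i => ?_
    funext v
    rw [hiter _ v (d v) (Nat.lt_succ_of_le (le_sup (mem_univ v))) (hd v)]
    simp
  have := Matrix.det_one_sub_of_isNilpotent hnil
  rwa [sub_sub_cancel] at this

lemma det_parentRow_of_not_exists (h : ¬ ∀ v, ∃ k, f^[k] v = r) :
    (of fun v => parentRow r v (f v)).det = 0 := by
  classical
  obtain ⟨v₀, hv₀⟩ := not_forall.1 h
  refine exists_mulVec_eq_zero_iff.1 ⟨fun v => if ∃ k, f^[k] v = r then 0 else 1, ?_, ?_⟩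
  · intro h0
    have := congrFun h0 v₀
    simp [hv₀] at this
  · funext v
    rw [parentRow_mulVec]
    split_ifs with hv h1 h2 h3 h4
    · rfl
    · exact absurd ⟨0, rfl⟩ h1
    · simp
    · obtain ⟨k, hk⟩ := h2
      cases k with
      | zero => exact absurd hk hv
      | succ k => exact absurd ⟨k, hk⟩ h3
    · obtain ⟨k, hk⟩ := h4
      exact absurd ⟨k + 1, hk⟩ h2
    · simp

/-- Kirchhoff's matrix-tree theorem. -/
theorem SimpleGraph.card_isTree_eq_det (G : SimpleGraph V) [DecidableRel G.Adj] (r : V) :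
    (Nat.card {H : SimpleGraph V // H ≤ G ∧ H.IsTree} : ℚ) =
      ((G.lapMatrix ℚ).updateRow r (Pi.single r 1)).det := by
  classical
  set A : V → Finset V := fun v => if v = r then {r} else G.neighborFinset v with hA
  have hrows : (G.lapMatrix ℚ).updateRow r (Pi.single r 1) =
      of fun v => ∑ u ∈ A v, parentRow r v u := by
    ext v w
    by_cases hv : v = r
    · subst hv
      simp [hA, parentRow]
    · simp [hA, parentRow, hv, lapMatrix, degMatrix, Matrix.diagonal_apply, Pi.single_apply,
        adjMatrix_apply, eq_comm (a := w)]
  have hsum := (detRowAlternating (n := V) (R := ℚ)).toMultilinearMap.map_sum_finset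
    (fun v u => parentRow r v u) A
  have hexp : (of fun v => ∑ u ∈ A v, parentRow r v u).det =
      ∑ f ∈ Fintype.piFinset A, (of fun v => parentRow r v (f v)).det := hsum
  have hdet : ∀ f : V → V, (of fun v => parentRow r v (f v)).det =
      if ∀ v, ∃ k, f^[k] v = r then 1 else 0 := by
    intro f
    split_ifs with h
    · exact det_parentRow_of_exists h
    · exact det_parentRow_of_not_exists h
  rw [hrows, hexp, sum_congr rfl fun f _ => hdet f, sum_boole, card_isTree_eq_card_isParentMap G r]
  congr 1
  rw [Nat.card_eq_fintype_card]
  refine Fintype.card_of_subtype _ fun f => ?_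
  rw [mem_filter, Fintype.mem_piFinset]
  constructor
  · rintro ⟨h1, h2⟩
    refine ⟨by simpa [hA] using h1 r, fun v hv => by simpa [hA, hv] using h1 v, h2⟩
  · rintro ⟨h1, h2, h3⟩
    refine ⟨fun v => ?_, h3⟩
    by_cases hv : v = r
    · subst hv
      simpa [hA] using h1
    · simpa [hA, hv] using h2 v hv

end

lemma det_updateRow_lapMatrix_completeBipartiteGraph {m n : ℕ} (hm : 0 < m) (r : Fin n)
    [DecidableRel (completeBipartiteGraph (Fin m) (Fin n)).Adj] :
    (((completeBipartiteGraph (Fin m) (Fin n)).lapMatrix ℚ).updateRow (Sum.inr r)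
      (Pi.single (Sum.inr r) 1)).det = (m : ℚ) ^ (n - 1) * (n : ℚ) ^ (m - 1) := by
  have hn : 0 < n := r.pos
  have hm' : (m : ℚ) ≠ 0 := by positivity
  have hn' : (n : ℚ) ≠ 0 := by positivity
  have hdegl : ∀ i, (completeBipartiteGraph (Fin m) (Fin n)).degree (Sum.inl i) = n := by
    intro i
    have : (completeBipartiteGraph (Fin m) (Fin n)).neighborFinset (Sum.inl i) =
        univ.map Function.Embedding.inr := by
      ext (j | j) <;> simp
    rw [← SimpleGraph.card_neighborFinset_eq_degree, this]
    simp
  have hdegr : ∀ i, (completeBipartiteGraph (Fin m) (Fin n)).degree (Sum.inr i) = m := by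
    intro i
    have : (completeBipartiteGraph (Fin m) (Fin n)).neighborFinset (Sum.inr i) =
        univ.map Function.Embedding.inl := by
      ext (j | j) <;> simp
    rw [← SimpleGraph.card_neighborFinset_eq_degree, this]
    simp
  set d : Fin n → ℚ := fun j => if j = r then 1 else m with hd
  set u : Fin n → ℚ := fun j => if j = r then 0 else -1 with hu
  have hblocks : ((completeBipartiteGraph (Fin m) (Fin n)).lapMatrix ℚ).updateRow (Sum.inr r)
      (Pi.single (Sum.inr r) 1) =
      fromBlocks (diagonal fun _ => (n : ℚ)) (of fun _ _ => -1) (of fun j _ => u j)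
        (diagonal d) := by
    ext (i | i) (j | j)
    · simp [SimpleGraph.lapMatrix, SimpleGraph.degMatrix, Matrix.diagonal_apply, hdegl,
        updateRow_apply]
    · simp [SimpleGraph.lapMatrix, SimpleGraph.degMatrix, updateRow_apply]
    · by_cases hi : i = r <;>
      simp [SimpleGraph.lapMatrix, SimpleGraph.degMatrix, updateRow_apply, hi, hu]
    · by_cases hi : i = r <;>
      simp [SimpleGraph.lapMatrix, SimpleGraph.degMatrix, updateRow_apply, hi, hd, hdegr,
        Matrix.diagonal_apply, Pi.single_apply, eq_comm (a := r)]
  have hdd : ∀ j, d j ≠ 0 := by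
    intro j
    simp only [hd]
    split_ifs
    · exact one_ne_zero
    · exact hm'
  have hprod : ∏ j, d j = (m : ℚ) ^ (n - 1) := by
    rw [← mul_prod_erase univ d (mem_univ r)]
    rw [prod_congr rfl (g := fun _ => (m : ℚ))]
    · simp [hd]
    · intro j hj
      simp [hd, (mem_erase.1 hj).1]
  let inst : Invertible (diagonal fun _ : Fin m => (n : ℚ)) :=
    invertibleOfLeftInverse _ (diagonal fun _ => (n : ℚ)⁻¹) (by
      rw [diagonal_mul_diagonal, ← diagonal_one]
      simp [hn'])
  have hinv : ⅟(diagonal fun _ : Fin m => (n : ℚ)) = diagonal fun _ => (n : ℚ)⁻¹ := rfl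
  have hschur : diagonal d - (of fun (j : Fin n) (_ : Fin m) => u j) *
      ⅟(diagonal fun _ : Fin m => (n : ℚ)) * (of fun (_ : Fin m) (_ : Fin n) => (-1 : ℚ)) =
      diagonal d * (1 + replicateCol Unit (fun j => m / n * u j / d j) *
        replicateRow Unit fun _ => (1 : ℚ)) := by
    rw [hinv, mul_add, mul_one, sub_eq_add_neg]
    congr 1
    ext i j
    rw [Matrix.neg_apply, mul_apply, diagonal_mul, mul_apply]
    simp [mul_diagonal]
    field_simp [hdd i]
  have hdot : (fun _ : Fin n => (1 : ℚ)) ⬝ᵥ (fun j => m / n * u j / d j) = -((n - 1 : ℚ) / n) := by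
    simp only [dotProduct, one_mul]
    rw [← add_sum_erase univ _ (mem_univ r), sum_congr rfl (g := fun _ => -(1 / n : ℚ))]
    · rw [sum_const, card_erase_of_mem (mem_univ _), card_univ, Fintype.card_fin, nsmul_eq_mul,
        Nat.cast_pred hn]
      simp [hu]
      ring
    · intro j hj
      simp only [hu, hd, (mem_erase.1 hj).1, if_false]
      field_simp
  rw [hblocks, det_fromBlocks₁₁, hschur, det_mul, det_one_add_replicateCol_mul_replicateRow,
    det_diagonal, det_diagonal, hprod, hdot]
  obtain ⟨k, rfl⟩ := Nat.exists_eq_succ_of_ne_zero hm.ne'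
  rw [prod_const, card_univ, Fintype.card_fin, Nat.succ_sub_one, pow_succ]
  field_simp
  ring

/-- The number of spanning trees of the complete bipartite graph `K_{m,n}` is
`m^(n-1) · n^(m-1)`. -/
theorem stmt6 (m n : ℕ) (hm : 0 < m) (hn : 0 < n) :
    tau (completeBipartiteGraph (Fin m) (Fin n)) = m ^ (n - 1) * n ^ (m - 1) := by
  classical
  have h := SimpleGraph.card_isTree_eq_det (completeBipartiteGraph (Fin m) (Fin n))
    (Sum.inr ⟨0, hn⟩)
  rw [det_updateRow_lapMatrix_completeBipartiteGraph hm] at h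
  unfold tau
  exact_mod_cast h
end

section
/- Let G be a threshold graph on n ≥ 1 vertices with an ordering v_1, …, v_n such that for every i, either N^<(v_i) = ∅ or N^<(v_i) = {v_1, …, v_{i−1}}. Let D = {v_i : i ≥ 2 and N^<(v_i) = {v_1, …, v_{i−1}}} and I = {v_i : i ≥ 2 and N^<(v_i) = ∅}. Then n · τ(G) = ∏_{v ∈ D} (deg(v) + 1) · ∏_{v ∈ I} deg(v), where deg(v) is the degree of v in G. -/
open scoped BigOperators

/-- The degree of a vertex. -/
noncomputable def deg {V : Type} (G : SimpleGraph V) (x : V) : ℕ :=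
  (G.neighborSet x).ncard

/-- The map `f` with distinguished vertex `r` is a parent function of a tree rooted at `r`:
iterating it from any vertex reaches `r`. -/
def ReachesRoot {V : Type} (r : V) (f : V → V) : Prop :=
  ∀ u, ∃ k, f^[k] u = r

/-- The graph whose edges join each non-root vertex to its image under `f`. -/
def parentGraph {V : Type} (r : V) (f : V → V) : SimpleGraph V :=
  SimpleGraph.fromRel fun a b => a ≠ r ∧ f a = b

/-- The row of the grounded Laplacian contributed by the arc from `u` to `x`. -/
def arcRow {V : Type} [DecidableEq V] (r u x : V) : V → ℤ := fun w =>
  if u = r then (if w = r then 1 else 0) else (if w = u then 1 else 0) - (if w = x then 1 else 0)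

/-- The admissible parents of a vertex; the root is its own parent. -/
noncomputable def parentChoices {V : Type} [Fintype V] [DecidableEq V] (G : SimpleGraph V)
    [DecidableRel G.Adj] (r u : V) : Finset V :=
  if u = r then {r} else G.neighborFinset u

/-- The Laplacian of `G` with the row of `r` replaced by the indicator of `r`. -/
noncomputable def groundedLaplacian {V : Type} [Fintype V] [DecidableEq V] (G : SimpleGraph V)
    [DecidableRel G.Adj] (r : V) : Matrix V V ℤ :=
  Matrix.of fun u => ∑ x ∈ parentChoices G r u, arcRow r u x

lemma ReachesRoot.exists_height {V : Type} {r : V} {f : V → V} (hf : ReachesRoot r f) :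
    ∃ h : V → ℕ, ∀ u, u ≠ r → h (f u) < h u := by
  classical
  refine ⟨fun u => Nat.find (hf u), fun u hu => ?_⟩
  have hs := Nat.find_spec (hf u)
  rcases hk : Nat.find (hf u) with _ | k
  · rw [hk] at hs
    exact absurd hs hu
  · rw [hk, Function.iterate_succ_apply] at hs
    exact Nat.lt_of_le_of_lt (Nat.find_min' (hf (f u)) hs) (by simp [hk])

lemma reachesRoot_of_height {V : Type} {r : V} {f : V → V} (h : V → ℕ)
    (hh : ∀ u, u ≠ r → h (f u) < h u) : ReachesRoot r f := by
  intro u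
  induction hn : h u using Nat.strong_induction_on generalizing u with
  | _ n ih =>
    by_cases hu : u = r
    · exact ⟨0, hu⟩
    · obtain ⟨k, hk⟩ := ih _ (hn ▸ hh u hu) (f u) rfl
      exact ⟨k + 1, hk⟩

lemma det_arcRow_of_reachesRoot {V : Type} [Fintype V] [DecidableEq V] {r : V} {f : V → V}
    (hf : ReachesRoot r f) : (Matrix.of fun u => arcRow r u (f u)).det = 1 := by
  obtain ⟨h, hh⟩ := hf.exists_height
  have hne : ∀ u, u ≠ r → ∀ w, h u ≤ h w → w ≠ f u := by
    rintro u hu w hw rfl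
    exact absurd (hh u hu) (by omega)
  have ht : (Matrix.of fun u => arcRow r u (f u)).BlockTriangular (OrderDual.toDual ∘ h) := by
    intro i j hij
    have hij : h i < h j := hij
    have hji : j ≠ i := by rintro rfl; omega
    by_cases hi : i = r
    · subst hi
      simp [arcRow, hji]
    · simp [arcRow, hi, hji, hne i hi j hij.le]
  rw [ht.det]
  refine Finset.prod_eq_one fun a _ => ?_
  suffices hs : (Matrix.of fun u => arcRow r u (f u)).toSquareBlock
      (OrderDual.toDual ∘ h) a = 1 by rw [hs, Matrix.det_one]
  ext ⟨i, hi⟩ ⟨j, hj⟩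
  have hij : h i = h j := OrderDual.toDual.injective (hi.trans hj.symm)
  by_cases hir : i = r
  · subst hir
    simp [Matrix.toSquareBlock_def, arcRow, Matrix.one_apply, eq_comm]
  · simp [Matrix.toSquareBlock_def, arcRow, hir, Matrix.one_apply, hne i hir j hij.le,
      eq_comm (a := j)]

lemma det_arcRow_of_not_reachesRoot {V : Type} [Fintype V] [DecidableEq V] {r : V} {f : V → V}
    (hf : ¬ ReachesRoot r f) : (Matrix.of fun u => arcRow r u (f u)).det = 0 := by
  classical
  rw [← Matrix.exists_mulVec_eq_zero_iff]
  refine ⟨fun u => if ∃ k, f^[k] u = r then 0 else 1, fun h0 => hf fun u => ?_, ?_⟩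
  · by_contra hu
    simpa [hu] using congrFun h0 u
  · have hr : ∃ k, f^[k] r = r := ⟨0, rfl⟩
    ext u
    by_cases hu : u = r
    · subst hu
      simp only [Matrix.mulVec, dotProduct, Matrix.of_apply, arcRow, if_true, ite_mul, one_mul,
        zero_mul, Finset.sum_ite_eq', Finset.mem_univ, hr, Pi.zero_apply]
    · have hiff : (∃ k, f^[k] (f u) = r) ↔ ∃ k, f^[k] u = r := by
        refine ⟨fun ⟨k, hk⟩ => ⟨k + 1, hk⟩, fun ⟨k, hk⟩ => ?_⟩
        rcases k with _ | k
        · exact absurd hk hu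
        · exact ⟨k, hk⟩
      simp only [Matrix.mulVec, dotProduct, Matrix.of_apply, arcRow, if_neg hu, sub_mul, ite_mul,
        one_mul, zero_mul, Finset.sum_sub_distrib, Finset.sum_ite_eq', Finset.mem_univ, if_true,
        hiff, sub_self, Pi.zero_apply]

/-- The matrix-tree theorem in terms of parent functions. -/
lemma det_groundedLaplacian {V : Type} [Fintype V] [DecidableEq V] (G : SimpleGraph V)
    [DecidableRel G.Adj] (r : V) :
    (groundedLaplacian G r).det =
      Nat.card {f : V → V // f ∈ Fintype.piFinset (parentChoices G r) ∧ ReachesRoot r f} := by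
  classical
  have h := MultilinearMap.map_sum_finset
    (Matrix.detRowAlternating (n := V) (R := ℤ)).toMultilinearMap
    (fun u x => arcRow r u x) (parentChoices G r)
  have h' : (groundedLaplacian G r).det =
      ∑ f ∈ Fintype.piFinset (parentChoices G r), (Matrix.of fun u => arcRow r u (f u)).det := h
  have hdet : ∀ f : V → V, (Matrix.of fun u => arcRow r u (f u)).det =
      if ReachesRoot r f then 1 else 0 := by
    intro f
    split_ifs with hf
    · exact det_arcRow_of_reachesRoot hf
    · exact det_arcRow_of_not_reachesRoot hf
  rw [h', Finset.sum_congr rfl fun f _ => hdet f, Finset.sum_boole, Nat.card_eq_fintype_card,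
    Fintype.card_subtype]
  congr 2
  ext f
  simp

lemma connected_parentGraph {V : Type} {r : V} {f : V → V} (hf : ReachesRoot r f) :
    (parentGraph r f).Connected := by
  obtain ⟨h, hh⟩ := hf.exists_height
  have key : ∀ u, (parentGraph r f).Reachable u r := by
    intro u
    induction hn : h u using Nat.strong_induction_on generalizing u with
    | _ n ih =>
      by_cases hu : u = r
      · rw [hu]
      · have hlt := hh u hu
        have hadj : (parentGraph r f).Adj u (f u) := by
          refine (SimpleGraph.fromRel_adj _ _ _).2 ⟨fun he => ?_, Or.inl ⟨hu, rfl⟩⟩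
          rw [← he] at hlt
          omega
        exact hadj.reachable.trans (ih _ (hn ▸ hlt) (f u) rfl)
  have : Nonempty V := ⟨r⟩
  exact ⟨fun a b => (key a).trans (key b).symm⟩

lemma isTree_parentGraph {V : Type} [Fintype V] {r : V} {f : V → V} (hf : ReachesRoot r f) :
    (parentGraph r f).IsTree := by
  classical
  have hc := connected_parentGraph hf
  refine SimpleGraph.isTree_iff_connected_and_card.2
    ⟨hc, le_antisymm ?_ hc.card_vert_le_card_edgeSet_add_one⟩
  have hsub : (parentGraph r f).edgeFinset ⊆
      (Finset.univ.erase r).image fun u => s(u, f u) := by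
    intro e
    induction e with
    | _ a b =>
      intro hab
      rw [SimpleGraph.mem_edgeFinset, SimpleGraph.mem_edgeSet] at hab
      simp only [Finset.mem_image, Finset.mem_erase, Finset.mem_univ, and_true]
      obtain ⟨-, ⟨ha, rfl⟩ | ⟨hb, rfl⟩⟩ := (SimpleGraph.fromRel_adj _ _ _).1 hab
      · exact ⟨a, ha, rfl⟩
      · exact ⟨b, hb, Sym2.eq_swap⟩
  have hle := (Finset.card_le_card hsub).trans Finset.card_image_le
  rw [Finset.card_erase_of_mem (Finset.mem_univ r), Finset.card_univ] at hle
  have hpos : 0 < Fintype.card V := Fintype.card_pos_iff.2 ⟨r⟩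
  rw [Nat.card_eq_fintype_card, Nat.card_eq_fintype_card, ← SimpleGraph.edgeFinset_card]
  omega

lemma parentGraph_injOn {V : Type} {r : V} {f g : V → V} (hf : ReachesRoot r f)
    (hfr : f r = r) (hgr : g r = r) (hfg : parentGraph r f = parentGraph r g) : f = g := by
  obtain ⟨h, hh⟩ := hf.exists_height
  funext u
  induction hn : h u using Nat.strong_induction_on generalizing u with
  | _ n ih =>
    by_cases hu : u = r
    · rw [hu, hfr, hgr]
    · have hlt := hh u hu
      have hadj : (parentGraph r f).Adj u (f u) := by
        refine (SimpleGraph.fromRel_adj _ _ _).2 ⟨fun he => ?_, Or.inl ⟨hu, rfl⟩⟩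
        rw [← he] at hlt
        omega
      rw [hfg] at hadj
      obtain ⟨-, ⟨-, h1⟩ | ⟨h1, h2⟩⟩ := (SimpleGraph.fromRel_adj _ _ _).1 hadj
      · exact h1.symm
      · have h3 := ih _ (hn ▸ hlt) (f u) rfl
        have h4 := hh (f u) h1
        rw [h3, h2] at h4
        omega

lemma exists_adj_dist_lt {V : Type} {H : SimpleGraph V} (hH : H.Connected) {u r : V}
    (hu : u ≠ r) : ∃ x, H.Adj u x ∧ H.dist x r < H.dist u r := by
  obtain ⟨p, hp⟩ := hH.exists_walk_length_eq_dist u r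
  cases p with
  | nil => exact absurd rfl hu
  | cons hadj q =>
    refine ⟨_, hadj, ?_⟩
    have := SimpleGraph.dist_le q
    rw [SimpleGraph.Walk.length_cons] at hp
    omega

lemma parentGraph_le {V : Type} {G : SimpleGraph V} {r : V} {f : V → V}
    (hf : ∀ u, u ≠ r → G.Adj u (f u)) : parentGraph r f ≤ G := by
  intro a b hab
  obtain ⟨-, ⟨ha, rfl⟩ | ⟨hb, rfl⟩⟩ := (SimpleGraph.fromRel_adj _ _ _).1 hab
  · exact hf a ha
  · exact (hf b hb).symm

lemma exists_parentGraph_eq {V : Type} {H : SimpleGraph V} (hH : H.IsTree) (r : V) :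
    ∃ f : V → V, f r = r ∧ (∀ u, u ≠ r → H.Adj u (f u)) ∧ ReachesRoot r f ∧
      parentGraph r f = H := by
  classical
  have hex : ∀ u, ∃ x, (u = r → x = r) ∧
      (u ≠ r → H.Adj u x ∧ H.dist x r < H.dist u r) := by
    intro u
    by_cases hu : u = r
    · exact ⟨r, fun _ => rfl, fun h => absurd hu h⟩
    · obtain ⟨x, hx⟩ := exists_adj_dist_lt hH.connected hu
      exact ⟨x, fun h => absurd h hu, fun _ => hx⟩
  choose f hfr hf using hex
  have hreach : ReachesRoot r f :=
    reachesRoot_of_height (fun u => H.dist u r) fun u hu => (hf u hu).2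
  have hle : parentGraph r f ≤ H := parentGraph_le fun u hu => (hf u hu).1
  exact ⟨f, hfr r rfl, fun u hu => (hf u hu).1, hreach, le_antisymm hle
    ((SimpleGraph.isTree_iff_minimal_connected.1 hH).2 (connected_parentGraph hreach) hle)⟩

lemma mem_piFinset_parentChoices {V : Type} [Fintype V] [DecidableEq V] {G : SimpleGraph V}
    [DecidableRel G.Adj] {r : V} {f : V → V} :
    f ∈ Fintype.piFinset (parentChoices G r) ↔ f r = r ∧ ∀ u, u ≠ r → G.Adj u (f u) := by
  rw [Fintype.mem_piFinset]
  refine ⟨fun h => ⟨by simpa [parentChoices] using h r, fun u hu => ?_⟩, fun h u => ?_⟩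
  · simpa [parentChoices, hu] using h u
  · by_cases hu : u = r
    · subst hu
      simp [parentChoices, h.1]
    · simpa [parentChoices, hu] using h.2 u hu

lemma tau_eq_card_parentFunctions {V : Type} [Fintype V] [DecidableEq V] (G : SimpleGraph V)
    [DecidableRel G.Adj] (r : V) :
    tau G =
      Nat.card {f : V → V // f ∈ Fintype.piFinset (parentChoices G r) ∧ ReachesRoot r f} := by
  symm
  refine Nat.card_congr (Equiv.ofBijective (fun f => ⟨parentGraph r f.1,
    parentGraph_le (mem_piFinset_parentChoices.1 f.2.1).2, isTree_parentGraph f.2.2⟩) ⟨?_, ?_⟩)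
  · rintro ⟨f, hf, hfr⟩ ⟨g, hg, hgr⟩ hfg
    exact Subtype.ext (parentGraph_injOn hfr (mem_piFinset_parentChoices.1 hf).1
      (mem_piFinset_parentChoices.1 hg).1 (congrArg Subtype.val hfg))
  · rintro ⟨H, hHG, hH⟩
    obtain ⟨f, hfr, hadj, hreach, rfl⟩ := exists_parentGraph_eq hH r
    exact ⟨⟨f, mem_piFinset_parentChoices.2 ⟨hfr, fun u hu => hHG (hadj u hu)⟩, hreach⟩, rfl⟩

lemma groundedLaplacian_root {V : Type} [Fintype V] [DecidableEq V] (G : SimpleGraph V)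
    [DecidableRel G.Adj] (r w : V) : groundedLaplacian G r r w = if w = r then 1 else 0 := by
  simp [groundedLaplacian, parentChoices, arcRow]

lemma lapMatrix_apply {V : Type} [Fintype V] [DecidableEq V] (G : SimpleGraph V)
    [DecidableRel G.Adj] (u w : V) :
    G.lapMatrix ℤ u w = (if w = u then (G.degree u : ℤ) else 0) - if G.Adj u w then 1 else 0 := by
  simp [SimpleGraph.lapMatrix, SimpleGraph.degMatrix, Matrix.diagonal_apply,
    SimpleGraph.adjMatrix_apply, eq_comm]

lemma groundedLaplacian_of_ne {V : Type} [Fintype V] [DecidableEq V] (G : SimpleGraph V)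
    [DecidableRel G.Adj] {r u : V} (hu : u ≠ r) (w : V) :
    groundedLaplacian G r u w = G.lapMatrix ℤ u w := by
  rw [lapMatrix_apply]
  simp [groundedLaplacian, parentChoices, arcRow, hu, Finset.sum_apply]

lemma sum_lapMatrix_col {V : Type} [Fintype V] [DecidableEq V] (G : SimpleGraph V)
    [DecidableRel G.Adj] (w : V) : ∑ u, G.lapMatrix ℤ u w = 0 := by
  have h := congrFun (G.lapMatrix_mulVec_const_eq_zero (R := ℤ)) w
  simp only [Matrix.mulVec, dotProduct, mul_one, Pi.zero_apply] at h
  rw [← h]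
  exact Finset.sum_congr rfl fun u _ => (G.isSymm_lapMatrix (R := ℤ)).apply w u

lemma card_mul_det_groundedLaplacian {V : Type} [Fintype V] [DecidableEq V] (G : SimpleGraph V)
    [DecidableRel G.Adj] (r : V) :
    (Fintype.card V : ℤ) * (groundedLaplacian G r).det =
      (Matrix.of fun k j => if k = r then (if j = r then 1 else 0)
        else G.lapMatrix ℤ k j - G.lapMatrix ℤ r j).det := by
  let x : V → ℤ := fun u => if u = r then 0 else 1
  have hx : 1 + x ⬝ᵥ x = Fintype.card V := by
    have : ∀ u, x u * x u = 1 - if u = r then 1 else 0 := by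
      intro u
      by_cases hu : u = r <;> simp [x, hu]
    simp [dotProduct, this, Finset.sum_sub_distrib]
  have hsum : ∀ j, ∑ l, x l * groundedLaplacian G r l j = - G.lapMatrix ℤ r j := by
    intro j
    have : ∀ l, x l * groundedLaplacian G r l j =
        G.lapMatrix ℤ l j - if l = r then G.lapMatrix ℤ r j else 0 := by
      intro l
      by_cases hl : l = r
      · simp [x, hl]
      · simp [x, hl, groundedLaplacian_of_ne]
    simp [this, Finset.sum_sub_distrib, sum_lapMatrix_col]
  rw [← hx, ← Matrix.det_one_add_replicateCol_mul_replicateRow (ι := Unit), ← Matrix.det_mul]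
  congr 1
  ext k j
  have hmul : ((1 + Matrix.replicateCol Unit x * Matrix.replicateRow Unit x) *
      groundedLaplacian G r : Matrix V V ℤ) k j =
        groundedLaplacian G r k j + x k * - G.lapMatrix ℤ r j := by
    rw [← hsum, add_mul, one_mul, Matrix.add_apply, Matrix.mul_apply, Finset.mul_sum]
    simp [Matrix.mul_apply, mul_assoc]
  rw [hmul]
  by_cases hk : k = r
  · subst hk
    simp [x, groundedLaplacian_root]
  · simp [x, hk, groundedLaplacian_of_ne, sub_eq_add_neg]

lemma deg_eq_degree {V : Type} [Fintype V] (G : SimpleGraph V) [DecidableRel G.Adj] (x : V) :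
    deg G x = G.degree x := by
  rw [deg, Set.ncard_eq_toFinset_card', ← SimpleGraph.card_neighborFinset_eq_degree]
  rfl

/-- The number of vertices times the number of spanning trees, for a graph with an ordering in
which each vertex is adjacent to none or to all of its predecessors. -/
lemma card_mul_tau_eq_prod {V : Type} [Fintype V] {n : ℕ} (hn : 1 ≤ n) (G : SimpleGraph V)
    [DecidableRel G.Adj] (v : Fin n ≃ V)
    (hv : ∀ i : Fin n, (∀ j < i, ¬ G.Adj (v i) (v j)) ∨ (∀ j < i, G.Adj (v i) (v j))) :
    ((Fintype.card V * tau G : ℕ) : ℤ) = ∏ i : Fin n, if (i : ℕ) = 0 then (1 : ℤ) else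
      G.degree (v i) + if G.Adj (v i) (v ⟨0, hn⟩) then 1 else 0 := by
  classical
  have hv' : ∀ i j k : Fin n, j < i → k < i → (G.Adj (v i) (v j) ↔ G.Adj (v i) (v k)) := by
    intro i j k hj hk
    rcases hv i with h | h
    · simp [h j hj, h k hk]
    · simp [h j hj, h k hk]
  rw [Nat.cast_mul, tau_eq_card_parentFunctions G (v ⟨0, hn⟩), ← det_groundedLaplacian,
    card_mul_det_groundedLaplacian, ← Matrix.det_submatrix_equiv_self v,
    Matrix.det_of_isLowerTriangular]
  · refine Finset.prod_congr rfl fun i _ => ?_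
    by_cases hi : (i : ℕ) = 0
    · have : i = ⟨0, hn⟩ := Fin.ext hi
      simp [this]
    · have : i ≠ ⟨0, hn⟩ := fun h => hi (congrArg Fin.val h)
      simp [this, hi, lapMatrix_apply, G.adj_comm (v i)]
  · intro i j hij
    have hij : i < j := hij
    have hj : j ≠ ⟨0, hn⟩ := by
      rintro rfl
      exact absurd hij (by simp [Fin.lt_def])
    by_cases hi : i = ⟨0, hn⟩
    · simp [hi, hj]
    · have h0 : (⟨0, hn⟩ : Fin n) < j := Fin.lt_def.2 (Nat.pos_of_ne_zero fun h => hj (Fin.ext h))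
      simp [hi, hj, hij.ne', lapMatrix_apply, G.adj_comm _ (v j), hv' j i _ hij h0]

/-- Spanning tree count of a threshold graph: with a construction order `v`, letting `D`
be the set of vertices (other than the first) whose lower neighborhood is all earlier
vertices and `I` those with empty lower neighborhood,
`n · τ(G) = ∏_{x ∈ D} (deg x + 1) · ∏_{x ∈ I} deg x`. -/
theorem stmt7 {V : Type} [Fintype V] (n : ℕ) (hn : 1 ≤ n)
    (hcard : Fintype.card V = n) (G : SimpleGraph V) (hG : IsThreshold G)
    (v : Fin n ≃ V)
    (hv : ∀ i : Fin n,
      (∀ j < i, ¬ G.Adj (v i) (v j)) ∨ (∀ j < i, G.Adj (v i) (v j))) :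
    n * tau G =
      (∏ᶠ x ∈ {x : V | ∃ i : Fin n, x = v i ∧ 1 ≤ (i : ℕ) ∧
          ∀ j < i, G.Adj (v i) (v j)}, (deg G x + 1)) *
      (∏ᶠ x ∈ {x : V | ∃ i : Fin n, x = v i ∧ 1 ≤ (i : ℕ) ∧
          ∀ j < i, ¬ G.Adj (v i) (v j)}, deg G x) := by
  classical
  have h0 : ∀ i : Fin n, 1 ≤ (i : ℕ) → (⟨0, hn⟩ : Fin n) < i := fun i hi => Fin.lt_def.2 hi
  rw [finprod_mem_eq_toFinset_prod, finprod_mem_eq_toFinset_prod]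
  simp only [Set.toFinset_ofPred, Finset.prod_filter]
  rw [← Finset.prod_mul_distrib, ← Equiv.prod_comp v]
  have h := card_mul_tau_eq_prod hn G v hv
  rw [hcard] at h
  rw [← Nat.cast_inj (R := ℤ), h, Nat.cast_prod]
  refine Finset.prod_congr rfl fun i _ => ?_
  simp only [EmbeddingLike.apply_eq_iff_eq, exists_eq_left', deg_eq_degree]
  by_cases hi : (i : ℕ) = 0
  · simp [hi]
  · have hi1 : 1 ≤ (i : ℕ) := Nat.pos_of_ne_zero hi
    rcases hv i with hI | hD
    · have hnD : ¬ ∀ j < i, G.Adj (v i) (v j) := fun hD => hI _ (h0 i hi1) (hD _ (h0 i hi1))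
      rw [if_neg hi, if_neg (hI _ (h0 i hi1)), if_neg (fun h => hnD h.2), if_pos ⟨hi1, hI⟩]
      simp
    · have hnI : ¬ ∀ j < i, ¬ G.Adj (v i) (v j) := fun hI => hI _ (h0 i hi1) (hD _ (h0 i hi1))
      rw [if_neg hi, if_pos (hD _ (h0 i hi1)), if_pos ⟨hi1, hD⟩, if_neg (fun h => hnI h.2)]
      simp
end

section
/- A finite simple graph G on n vertices is special 2-threshold if and only if there exist an ordering v_1, …, v_n of its vertices and column vectors a, b ∈ ℝ^n such that L + a bᵀ is upper triangular, where L is the Laplacian matrix of G with respect to this ordering and a bᵀ is the n × n outer-product matrix with (i,j) entry a_i b_j. -/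
/-- `G` is special 2-threshold if it is `U`-threshold for some vertex subset `U`. -/
def IsSpecial2Threshold {V : Type} (G : SimpleGraph V) : Prop :=
  ∃ U : Set V, IsUThreshold G U

/- The Laplacian matrix of `G` with respect to the vertex ordering `v`. -/
open Classical in
noncomputable def lapOrd {V : Type} {n : ℕ} (G : SimpleGraph V) (v : Fin n ≃ V) :
    Matrix (Fin n) (Fin n) ℝ :=
  Matrix.of fun i j =>
    if i = j then (deg G (v i) : ℝ) else if G.Adj (v i) (v j) then -1 else 0

/-- The vertices of a finite subset can be listed so that each vertex is adjacent either to none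
of its predecessors or exactly to those in `U`. -/
theorem IsUThreshold.exists_enumeration {V : Type} {G : SimpleGraph V} {U : Set V}
    (h : IsUThreshold G U) (n : ℕ) (W : Finset V) (hW : W.card = n) :
    ∃ f : Fin n → V, Function.Injective f ∧ (∀ i, f i ∈ W) ∧
      ∀ i, (∀ j < i, ¬ G.Adj (f i) (f j)) ∨ (∀ j < i, G.Adj (f i) (f j) ↔ f j ∈ U) := by
  classical
  induction n generalizing W with
  | zero => exact ⟨Fin.elim0, fun i => i.elim0, fun i => i.elim0, fun i => i.elim0⟩
  | succ n ih =>
    obtain ⟨x, hxW, hx⟩ := h W (Finset.card_pos.mp (by omega))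
    rw [Finset.mem_coe] at hxW
    obtain ⟨f, hf, hfW, hadj⟩ := ih (W.erase x) (by rw [Finset.card_erase_of_mem hxW]; omega)
    have hfx : ∀ i, f i ≠ x ∧ f i ∈ W := fun i => Finset.mem_erase.mp (hfW i)
    refine ⟨Fin.snoc f x, ?_, ?_, ?_⟩
    · rw [Fin.snoc_injective_iff]
      refine ⟨hf, ?_⟩
      rintro ⟨i, hi⟩
      exact (hfx i).1 hi
    · intro i
      induction i using Fin.lastCases with
      | last => simpa using hxW
      | cast i => simpa using (hfx i).2
    · intro i
      induction i using Fin.lastCases with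
      | last =>
        refine hx.imp (fun hx j hj => ?_) (fun hx j hj => ?_)
        all_goals
          induction j using Fin.lastCases with
          | last => exact absurd hj (lt_irrefl _)
          | cast j =>
            have := Set.ext_iff.mp hx (f j)
            simpa [hfx j] using this
      | cast i =>
        refine (hadj i).imp (fun hi j hj => ?_) (fun hi j hj => ?_)
        all_goals
          induction j using Fin.lastCases with
          | last => exact absurd hj (Fin.castSucc_lt_last i).not_gt
          | cast j => simpa using hi j (Fin.castSucc_lt_castSucc_iff.mp hj)

/-- An ordering in which each vertex is adjacent either to none of its predecessors or exactly to
those in `U` witnesses that the graph is `U`-threshold. -/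
theorem isUThreshold_of_ordering {V : Type} {n : ℕ} {G : SimpleGraph V} {U : Set V}
    (v : Fin n ≃ V)
    (h : ∀ i, (∀ j < i, ¬ G.Adj (v i) (v j)) ∨ (∀ j < i, G.Adj (v i) (v j) ↔ v j ∈ U)) :
    IsUThreshold G U := by
  intro W hW
  obtain ⟨i, hi, hmax⟩ := Set.exists_max_image (v ⁻¹' W) id (Set.toFinite _)
    (hW.preimage v.surjective)
  have hlt : ∀ j, v j ∈ W → j ≠ i → j < i := fun j hj hne => lt_of_le_of_ne (hmax j hj) hne
  refine ⟨v i, hi, (h i).imp (fun h => ?_) (fun h => ?_)⟩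
  · ext y
    obtain ⟨j, rfl⟩ := v.surjective y
    by_cases hji : j = i
    · simp [hji]
    · simpa using fun hj => h j (hlt j hj hji)
  · ext y
    obtain ⟨j, rfl⟩ := v.surjective y
    by_cases hji : j = i
    · simp [hji]
    · simpa [hji] using fun hj => h j (hlt j hj hji)

/-- A graph on `n` vertices is special 2-threshold iff for some ordering of its vertices
its Laplacian matrix admits an upper triangular rank-one perturbation `L + a bᵀ`. -/
theorem stmt11 {V : Type} [Fintype V] (n : ℕ) (hcard : Fintype.card V = n)
    (G : SimpleGraph V) :
    IsSpecial2Threshold G ↔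
      ∃ (v : Fin n ≃ V) (a b : Fin n → ℝ),
        ∀ i j : Fin n, j < i → lapOrd G v i j + a i * b j = 0 := by
  classical
  constructor
  · rintro ⟨U, hU⟩
    obtain ⟨f, hf, -, hadj⟩ := hU.exists_enumeration n Finset.univ hcard
    have hbij : Function.Bijective f :=
      (Fintype.bijective_iff_injective_and_card f).mpr ⟨hf, by simp [hcard]⟩
    refine ⟨Equiv.ofBijective f hbij, fun i => if ∀ j < i, ¬ G.Adj (f i) (f j) then 0 else 1,
      fun j => if f j ∈ U then 1 else 0, fun i j hji => ?_⟩
    simp only [lapOrd, Matrix.of_apply, Equiv.ofBijective_apply, if_neg hji.ne']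
    by_cases hi : ∀ j < i, ¬ G.Adj (f i) (f j)
    · rw [if_pos hi, if_neg (hi j hji), zero_mul, add_zero]
    · have hij := (hadj i).resolve_left hi j hji
      rw [if_neg hi]
      by_cases hj : f j ∈ U <;> simp [hij, hj]
  · rintro ⟨v, a, b, h⟩
    refine ⟨{y | b (v.symm y) ≠ 0}, isUThreshold_of_ordering v fun i => ?_⟩
    have hadj : ∀ j < i, G.Adj (v i) (v j) ↔ a i * b j ≠ 0 := by
      intro j hji
      have hij := h i j hji
      simp only [lapOrd, Matrix.of_apply, if_neg hji.ne'] at hij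
      by_cases hG : G.Adj (v i) (v j)
      · rw [if_pos hG] at hij
        refine iff_of_true hG fun h0 => ?_
        norm_num [h0] at hij
      · rw [if_neg hG, zero_add] at hij
        exact iff_of_false hG (not_not.mpr hij)
    by_cases ha : a i = 0
    · exact Or.inl fun j hji => by simp [hadj j hji, ha]
    · exact Or.inr fun j hji => by simp [hadj j hji, ha]
end

section
/- A finite simple graph G = (V, E) on n vertices is special 2-threshold if and only if there exist an ordering v_1, …, v_n of V and a subset U ⊆ V such that for every i ∈ {1, …, n}, either N^<(v_i) = ∅ or N^<(v_i) = U ∩ {v_1, …, v_{i−1}}. -/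
/-- If from every nonempty set one can pick an element related to the rest of the set, then the
elements can be ordered so that each one is related to the set of its predecessors. -/
theorem exists_equiv_fin_forall_lower {V : Type*} [Fintype V] {n : ℕ} (hcard : Fintype.card V = n)
    (P : V → Set V → Prop) (hP : ∀ W : Set V, W.Nonempty → ∃ x ∈ W, P x (W \ {x})) :
    ∃ v : Fin n ≃ V, ∀ i, P (v i) {u | v.symm u < i} := by
  classical
  have key : ∀ (k : ℕ) (W : Finset V), W.card = k → ∃ r : V → ℕ, Set.InjOn r W ∧
      (∀ x ∈ W, r x < k) ∧ ∀ x ∈ W, P x {u | u ∈ W ∧ r u < r x} := by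
    intro k
    induction k with
    | zero =>
      intro W hW
      obtain rfl := Finset.card_eq_zero.mp hW
      exact ⟨fun _ => 0, by simp⟩
    | succ k ih =>
      intro W hW
      obtain ⟨x, hx, hPx⟩ := hP W (by
        rw [Finset.coe_nonempty, ← Finset.card_pos]
        omega)
      have hxW : x ∈ W := hx
      obtain ⟨r, hinj, hlt, hr⟩ := ih (W.erase x) (by rw [Finset.card_erase_of_mem hxW]; omega)
      have hlt' : ∀ y ∈ W, y ≠ x → r y < k := fun y hy hne =>
        hlt y (Finset.mem_erase.mpr ⟨hne, hy⟩)
      refine ⟨Function.update r x k, ?_, ?_, ?_⟩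
      · intro a ha b hb hab
        have ha' : a ∈ W := ha
        have hb' : b ∈ W := hb
        by_cases hax : a = x <;> by_cases hbx : b = x
        · rw [hax, hbx]
        · have := hlt' b hb' hbx
          simp [hax, hbx] at hab
          omega
        · have := hlt' a ha' hax
          simp [hax, hbx] at hab
          omega
        · simp only [Function.update_of_ne hax, Function.update_of_ne hbx] at hab
          exact hinj (by simp [hax, ha']) (by simp [hbx, hb']) hab
      · intro y hy
        by_cases hyx : y = x
        · simp [hyx]
        · have := hlt' y hy hyx
          rw [Function.update_of_ne hyx]
          omega
      · intro y hy
        by_cases hyx : y = x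
        · subst hyx
          convert hPx using 1
          ext u
          by_cases huy : u = y
          · simp [huy]
          · simpa [huy] using fun hu => hlt' u hu huy
        · convert hr y (Finset.mem_erase.mpr ⟨hyx, hy⟩) using 1
          ext u
          by_cases hux : u = x
          · simpa [hux, hyx] using fun _ => (hlt' y hy hyx).le
          · simp [hux, hyx]
  obtain ⟨r, hinj, hlt, hr⟩ := key n Finset.univ (by rw [Finset.card_univ, hcard])
  let f : V → Fin n := fun x => ⟨r x, hlt x (Finset.mem_univ x)⟩
  have hf : Function.Bijective f := by
    rw [Fintype.bijective_iff_injective_and_card]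
    exact ⟨fun a b hab => hinj (by simp) (by simp) (congrArg Fin.val hab), by simp [hcard]⟩
  refine ⟨(Equiv.ofBijective f hf).symm, fun i => ?_⟩
  obtain ⟨x, rfl⟩ := hf.surjective i
  rw [Equiv.ofBijective_symm_apply_apply]
  simpa [f] using hr x (Finset.mem_univ x)

/-- A graph on `n` vertices is special 2-threshold iff there are an ordering
`v 0, …, v (n-1)` of its vertices and a subset `U` such that every lower neighborhood
`N^<(v i)` is empty or equals `U ∩ {v 0, …, v (i-1)}`. -/
theorem stmt12 {V : Type} [Fintype V] (n : ℕ) (hcard : Fintype.card V = n)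
    (G : SimpleGraph V) :
    IsSpecial2Threshold G ↔
      ∃ (v : Fin n ≃ V) (U : Set V), ∀ i : Fin n,
        ({u : V | G.Adj (v i) u ∧ v.symm u < i} = (∅ : Set V)) ∨
        ({u : V | G.Adj (v i) u ∧ v.symm u < i} = U ∩ {u : V | v.symm u < i}) := by
  constructor
  · rintro ⟨U, hU⟩
    obtain ⟨v, hv⟩ := exists_equiv_fin_forall_lower hcard
      (fun x S => {u | G.Adj x u ∧ u ∈ S} = ∅ ∨ {u | G.Adj x u ∧ u ∈ S} = U ∩ S) (by
        intro W hW
        obtain ⟨x, hx, h⟩ := hU W hW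
        have hset : {u | G.Adj x u ∧ u ∈ W \ {x}} = {y ∈ W | G.Adj x y} := by
          ext u
          constructor
          · exact fun h => ⟨h.2.1, h.1⟩
          · exact fun h => ⟨h.2, h.1, h.2.ne'⟩
        refine ⟨x, hx, ?_⟩
        rwa [hset, Set.inter_comm U])
    exact ⟨v, U, hv⟩
  · rintro ⟨v, U, hv⟩
    refine ⟨U, fun W hW => ?_⟩
    obtain ⟨x, hx, hmax⟩ := W.toFinite.exists_maximalFor v.symm W hW
    have hlt : ∀ y ∈ W, y ≠ x → v.symm y < v.symm x := fun y hy hne =>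
      lt_of_le_of_ne ((le_total _ _).elim id (hmax hy)) (v.symm.injective.ne hne)
    have h := hv (v.symm x)
    simp only [Equiv.apply_symm_apply, Set.ext_iff, Set.mem_ofPred_eq, Set.mem_inter_iff,
      Set.mem_empty_iff_false, iff_false] at h
    refine ⟨x, hx, h.imp (fun h => ?_) fun h => ?_⟩
    · ext y
      simpa using fun hy hadj => h y ⟨hadj, hlt y hy hadj.ne'⟩
    · ext y
      constructor
      · rintro ⟨hy, hadj⟩
        exact ⟨⟨hy, hadj.ne'⟩, ((h y).mp ⟨hadj, hlt y hy hadj.ne'⟩).1⟩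
      · rintro ⟨⟨hy, hne⟩, hyU⟩
        exact ⟨hy, ((h y).mpr ⟨hyU, hlt y hy hne⟩).1⟩
end

section
/- Let G = (V, E) be a U-threshold graph for some U ⊆ V, and let U^c = V ∖ U. Then: (a) U^c is an independent set in G (no edge of G joins two vertices of U^c); (b) the neighborhoods of the vertices in U^c are nested, i.e., for all v, w ∈ U^c, N(v) ⊆ N(w) or N(w) ⊆ N(v); and (c) the neighborhoods of the vertices in U restricted to U^c are nested, i.e., for all v, w ∈ U, N_{U^c}(v) ⊆ N_{U^c}(w) or N_{U^c}(w) ⊆ N_{U^c}(v), where N(v) denotes the neighborhood of v in G and N_{U^c}(v) = N(v) ∩ U^c. -/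
theorem IsUThreshold.exists_forall_adj {V : Type} {G : SimpleGraph V} {U : Set V}
    (h : IsUThreshold G U) {W : Set V} (hW : W.Nonempty) :
    ∃ x ∈ W, (∀ y ∈ W, ¬ G.Adj x y) ∨ ∀ y ∈ W, G.Adj x y ↔ y ≠ x ∧ y ∈ U := by
  obtain ⟨x, hx, hxW | hxW⟩ := h W hW
  · exact ⟨x, hx, .inl fun y hy hxy => (Set.ext_iff.mp hxW y).mp ⟨hy, hxy⟩⟩
  · refine ⟨x, hx, .inr fun y hy => ?_⟩
    simpa [hy] using Set.ext_iff.mp hxW y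

theorem IsUThreshold.not_adj {V : Type} {G : SimpleGraph V} {U : Set V}
    (h : IsUThreshold G U) {x y : V} (hx : x ∉ U) (hy : y ∉ U) : ¬ G.Adj x y := by
  intro hxy
  obtain ⟨z, hz, hzW⟩ := h.exists_forall_adj (W := {x, y}) ⟨x, by simp⟩
  have hyx := hxy.symm
  rcases hz with rfl | rfl <;> simp_all

/-- Two edges crossing between `U` and its complement are joined by a third crossing edge. -/
theorem IsUThreshold.adj_or_adj {V : Type} {G : SimpleGraph V} {U : Set V}
    (h : IsUThreshold G U) {a b v w : V} (ha : a ∈ U) (hb : b ∈ U) (hv : v ∉ U) (hw : w ∉ U)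
    (hav : G.Adj a v) (hbw : G.Adj b w) : G.Adj a w ∨ G.Adj b v := by
  by_contra! ⟨haw, hbv⟩
  have hva := hav.symm
  have hwb := hbw.symm
  have hwa : ¬ G.Adj w a := fun hwa => haw hwa.symm
  have hvb : ¬ G.Adj v b := fun hvb => hbv hvb.symm
  have hvb_ne : b ≠ v := fun e => hv (e ▸ hb)
  have hwa_ne : a ≠ w := fun e => hw (e ▸ ha)
  obtain ⟨z, hz, hzW⟩ := h.exists_forall_adj (W := {a, b, v, w}) ⟨a, by simp⟩
  rcases hz with rfl | rfl | rfl | rfl <;> simp_all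

/-- For a `U`-threshold graph `G` with `Uᶜ = V ∖ U`:
(a) `Uᶜ` is an independent set; (b) the neighborhoods of vertices of `Uᶜ` are nested;
(c) the neighborhoods of vertices of `U` restricted to `Uᶜ` are nested. -/
theorem stmt14 {V : Type} (G : SimpleGraph V) (U : Set V) (h : IsUThreshold G U) :
    (∀ x ∈ Uᶜ, ∀ y ∈ Uᶜ, ¬ G.Adj x y) ∧
    (∀ v ∈ Uᶜ, ∀ w ∈ Uᶜ,
      G.neighborSet v ⊆ G.neighborSet w ∨ G.neighborSet w ⊆ G.neighborSet v) ∧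
    (∀ v ∈ U, ∀ w ∈ U,
      G.neighborSet v ∩ Uᶜ ⊆ G.neighborSet w ∩ Uᶜ ∨
      G.neighborSet w ∩ Uᶜ ⊆ G.neighborSet v ∩ Uᶜ) := by
  refine ⟨fun x hx y hy => h.not_adj hx hy, fun v hv w hw => ?_, fun v hv w hw => ?_⟩
  · by_contra! ⟨hvw, hwv⟩
    obtain ⟨a, hva, hwa⟩ := Set.not_subset.mp hvw
    obtain ⟨b, hwb, hvb⟩ := Set.not_subset.mp hwv
    have ha : a ∈ U := by_contra fun ha => h.not_adj hv ha hva
    have hb : b ∈ U := by_contra fun hb => h.not_adj hw hb hwb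
    rcases h.adj_or_adj ha hb hv hw hva.symm hwb.symm with haw | hbv
    · exact hwa haw.symm
    · exact hvb hbv.symm
  · by_contra! ⟨hvw, hwv⟩
    obtain ⟨a, ⟨hva, ha⟩, hwa⟩ := Set.not_subset.mp hvw
    obtain ⟨b, ⟨hwb, hb⟩, hvb⟩ := Set.not_subset.mp hwv
    rcases h.adj_or_adj hv hw ha hb hva hwb with hvb' | hwa'
    · exact hvb ⟨hvb', hb⟩
    · exact hwa ⟨hwa', ha⟩
end

section
/- A connected finite simple graph G on at least two vertices is Ferrers if and only if there exists an independent set U of vertices of G such that G is U-threshold. -/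
/-- A finite set on which a set-valued map takes pairwise comparable values can be enumerated
so that the map is antitone. -/
theorem exists_antitone_enumeration {V : Type} [Finite V] (S : Set V) (N : V → Set V)
    (h : ∀ a ∈ S, ∀ b ∈ S, N a ⊆ N b ∨ N b ⊆ N a) :
    ∃ (n : ℕ) (r : Fin n → V), Function.Injective r ∧ Set.range r = S ∧
      ∀ i k : Fin n, i ≤ k → N (r k) ⊆ N (r i) := by
  obtain ⟨n, ⟨e⟩⟩ := Finite.exists_equiv_fin S
  let f : Fin n → ℕᵒᵈ := fun i => OrderDual.toDual (N (e.symm i)).ncard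
  let r : Fin n → V := fun i => e.symm (Tuple.sort f i)
  have hmem : ∀ i, r i ∈ S := fun i => (e.symm (Tuple.sort f i)).2
  refine ⟨n, r, fun i j hij => ?_, ?_, fun i k hik => ?_⟩
  · exact (Tuple.sort f).injective (e.symm.injective (Subtype.ext hij))
  · ext x
    constructor
    · rintro ⟨i, rfl⟩
      exact hmem i
    · intro hx
      exact ⟨(Tuple.sort f).symm (e ⟨x, hx⟩), by simp [r]⟩
  · have hle : (N (r k)).ncard ≤ (N (r i)).ncard := Tuple.monotone_sort f hik
    rcases h _ (hmem i) _ (hmem k) with hsub | hsub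
    · exact (Set.eq_of_subset_of_ncard_le hsub hle (Set.toFinite _)).ge
    · exact hsub

theorem IsFerrers.exists_isUThreshold {V : Type} {G : SimpleGraph V} (hG : IsFerrers G) :
    ∃ U : Set V, (∀ x ∈ U, ∀ y ∈ U, ¬ G.Adj x y) ∧ IsUThreshold G U := by
  obtain ⟨m, n, -, -, r, c, hr, hc, hrc, hcover, hadj, -, -, hdown⟩ := hG
  have hcc : ∀ i j, ¬ G.Adj (c i) (c j) := by
    intro i j hij
    rcases hadj _ _ hij with ⟨a, b, h, -⟩ | ⟨a, b, -, h⟩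
    · exact hrc _ _ h.symm
    · exact hrc _ _ h.symm
  have hrr : ∀ i j, ¬ G.Adj (r i) (r j) := by
    intro i j hij
    rcases hadj _ _ hij with ⟨a, b, -, h⟩ | ⟨a, b, h, -⟩
    · exact hrc _ _ h
    · exact hrc _ _ h
  refine ⟨Set.range c, ?_, ?_⟩
  · rintro _ ⟨i, rfl⟩ _ ⟨j, rfl⟩
    exact hcc i j
  intro W ⟨w, hw⟩
  by_cases hR : ∃ i, r i ∈ W
  · obtain ⟨i, hi, hmin⟩ := (Set.toFinite {i | r i ∈ W}).exists_minimal hR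
    have hmin' : ∀ k, r k ∈ W → i ≤ k := fun k hk => (le_total i k).elim id (hmin hk)
    by_cases hC : ∃ j, c j ∈ W
    · obtain ⟨j, hj, hmax⟩ := (Set.toFinite {j | c j ∈ W}).exists_maximal hC
      have hmax' : ∀ l, c l ∈ W → l ≤ j := fun l hl => (le_total l j).elim id (hmax hl)
      by_cases hij : G.Adj (r i) (c j)
      · refine ⟨r i, hi, Or.inr ?_⟩
        ext y
        constructor
        · rintro ⟨hy, hiy⟩
          refine ⟨⟨hy, hiy.ne'⟩, ?_⟩
          rcases hcover y with ⟨k, rfl⟩ | ⟨l, rfl⟩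
          · exact absurd hiy (hrr _ _)
          · exact ⟨l, rfl⟩
        · rintro ⟨⟨hy, -⟩, l, rfl⟩
          exact ⟨hy, hdown _ _ hij _ _ le_rfl (hmax' l hy)⟩
      · refine ⟨c j, hj, Or.inl (Set.eq_empty_of_forall_notMem ?_)⟩
        rintro y ⟨hy, hjy⟩
        rcases hcover y with ⟨k, rfl⟩ | ⟨l, rfl⟩
        · exact hij (hdown _ _ hjy.symm _ _ (hmin' k hy) le_rfl)
        · exact hcc _ _ hjy
    · refine ⟨r i, hi, Or.inl (Set.eq_empty_of_forall_notMem ?_)⟩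
      rintro y ⟨hy, hiy⟩
      rcases hcover y with ⟨k, rfl⟩ | ⟨l, rfl⟩
      · exact hrr _ _ hiy
      · exact hC ⟨l, hy⟩
  · refine ⟨w, hw, Or.inl (Set.eq_empty_of_forall_notMem ?_)⟩
    rintro y ⟨hy, hwy⟩
    rcases hadj _ _ hwy with ⟨a, -, rfl, -⟩ | ⟨-, b, -, rfl⟩
    · exact hR ⟨a, hw⟩
    · exact hR ⟨b, hy⟩

theorem IsUThreshold.not_adj_of_notMem {V : Type} {G : SimpleGraph V} {U : Set V}
    (hT : IsUThreshold G U) {x y : V} (hx : x ∉ U) (hy : y ∉ U) : ¬ G.Adj x y := by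
  intro hxy
  obtain ⟨z, hz, h⟩ := hT {x, y} ⟨x, by simp⟩
  rcases hz with rfl | rfl
  · rcases h with h | h
    · exact (h.le ⟨Or.inr rfl, hxy⟩ : y ∈ (∅ : Set V))
    · exact hy (h.le ⟨Or.inr rfl, hxy⟩).2
  · rcases h with h | h
    · exact (h.le ⟨Or.inl rfl, hxy.symm⟩ : x ∈ (∅ : Set V))
    · exact hx (h.le ⟨Or.inl rfl, hxy.symm⟩).2

/-- Between an independent set `U` and its complement, a `U`-threshold graph has no induced
matching with two edges. -/
theorem IsUThreshold.adj_or_adj_s15 {V : Type} {G : SimpleGraph V} {U : Set V}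
    (hU : ∀ x ∈ U, ∀ y ∈ U, ¬ G.Adj x y) (hT : IsUThreshold G U) {a b c d : V}
    (ha : a ∉ U) (hb : b ∉ U) (hc : c ∈ U) (hd : d ∈ U)
    (hac : G.Adj a c) (hbd : G.Adj b d) : G.Adj a d ∨ G.Adj b c := by
  by_contra! hcon
  obtain ⟨had, hbc⟩ := hcon
  have hcd : c ≠ d := fun h => had (h ▸ hac)
  obtain ⟨z, hz, h⟩ := hT {a, b, c, d} ⟨a, by simp⟩
  have hadj : ∃ y ∈ ({a, b, c, d} : Set V), G.Adj z y := by
    rcases hz with rfl | rfl | rfl | rfl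
    · exact ⟨c, by simp, hac⟩
    · exact ⟨d, by simp, hbd⟩
    · exact ⟨a, by simp, hac.symm⟩
    · exact ⟨b, by simp, hbd.symm⟩
  obtain ⟨y, hy, hzy⟩ := hadj
  rcases h with h | h
  · exact (h ▸ (⟨hy, hzy⟩ : y ∈ {y ∈ ({a, b, c, d} : Set V) | G.Adj z y}) : y ∈ (∅ : Set V))
  · have key : ∀ u ∈ ({a, b, c, d} : Set V), u ≠ z → u ∈ U → G.Adj z u := fun u hu hne huU =>
      (h.ge ⟨⟨hu, hne⟩, huU⟩).2
    rcases hz with rfl | rfl | rfl | rfl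
    · exact had (key d (by simp) (fun e => ha (e ▸ hd)) hd)
    · exact hbc (key c (by simp) (fun e => hb (e ▸ hc)) hc)
    · exact hU _ hc _ hd (key d (by simp) hcd.symm hd)
    · exact hU _ hd _ hc (key c (by simp) hcd hc)

theorem IsUThreshold.isFerrers {V : Type} [Finite V] {G : SimpleGraph V} {U : Set V}
    [Nonempty V] (hnbr : ∀ v, ∃ w, G.Adj v w)
    (hU : ∀ x ∈ U, ∀ y ∈ U, ¬ G.Adj x y) (hT : IsUThreshold G U) : IsFerrers G := by
  have hnestR : ∀ a ∈ Uᶜ, ∀ b ∈ Uᶜ,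
      G.neighborSet a ⊆ G.neighborSet b ∨ G.neighborSet b ⊆ G.neighborSet a := by
    intro a ha b hb
    by_contra! hcon
    obtain ⟨h₁, h₂⟩ := hcon
    obtain ⟨c, hac, hbc⟩ := Set.not_subset.1 h₁
    obtain ⟨d, hbd, had⟩ := Set.not_subset.1 h₂
    have hc : c ∈ U := by_contra fun hc => hT.not_adj_of_notMem ha hc hac
    have hd : d ∈ U := by_contra fun hd => hT.not_adj_of_notMem hb hd hbd
    exact (hT.adj_or_adj_s15 hU ha hb hc hd hac hbd).elim had hbc
  have hnestC : ∀ c ∈ U, ∀ d ∈ U,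
      G.neighborSet c ⊆ G.neighborSet d ∨ G.neighborSet d ⊆ G.neighborSet c := by
    intro c hc d hd
    by_contra! hcon
    obtain ⟨h₁, h₂⟩ := hcon
    obtain ⟨a, hca, hda⟩ := Set.not_subset.1 h₁
    obtain ⟨b, hdb, hcb⟩ := Set.not_subset.1 h₂
    have ha : a ∉ U := fun ha => hU _ hc _ ha hca
    have hb : b ∉ U := fun hb => hU _ hd _ hb hdb
    exact (hT.adj_or_adj_s15 hU ha hb hc hd (G.adj_symm hca) (G.adj_symm hdb)).elim
      (fun h => hda h.symm) (fun h => hcb h.symm)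
  obtain ⟨m, r, hr, hrange, hrmono⟩ := exists_antitone_enumeration Uᶜ G.neighborSet hnestR
  obtain ⟨n, c, hc, hcrange, hcmono⟩ := exists_antitone_enumeration U G.neighborSet hnestC
  have hrU : ∀ i, r i ∉ U := fun i => hrange.le ⟨i, rfl⟩
  have hcU : ∀ j, c j ∈ U := fun j => hcrange.le ⟨j, rfl⟩
  have hrof : ∀ x ∉ U, ∃ i, x = r i := fun x hx => (hrange.ge hx).imp fun _ => Eq.symm
  have hcof : ∀ x ∈ U, ∃ j, x = c j := fun x hx => (hcrange.ge hx).imp fun _ => Eq.symm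
  have hradj : ∀ i, ∃ j, G.Adj (r i) (c j) := by
    intro i
    obtain ⟨y, hy⟩ := hnbr (r i)
    obtain ⟨j, rfl⟩ := hcof y (by_contra fun h => hT.not_adj_of_notMem (hrU i) h hy)
    exact ⟨j, hy⟩
  have hcadj : ∀ j, ∃ i, G.Adj (r i) (c j) := by
    intro j
    obtain ⟨y, hy⟩ := hnbr (c j)
    obtain ⟨i, rfl⟩ := hrof y fun h => hU _ (hcU j) _ h hy
    exact ⟨i, hy.symm⟩
  have hpos : 0 < m ∧ 0 < n := by
    obtain ⟨v⟩ := ‹Nonempty V›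
    by_cases hv : v ∈ U
    · obtain ⟨j, -⟩ := hcof v hv
      obtain ⟨i, -⟩ := hcadj j
      exact ⟨i.pos, j.pos⟩
    · obtain ⟨i, -⟩ := hrof v hv
      obtain ⟨j, -⟩ := hradj i
      exact ⟨i.pos, j.pos⟩
  have hdown : ∀ (k : Fin m) (l : Fin n), G.Adj (r k) (c l) →
      ∀ (i : Fin m) (j : Fin n), i ≤ k → j ≤ l → G.Adj (r i) (c j) := by
    intro k l hkl i j hik hjl
    have hil : G.Adj (r i) (c l) := hrmono i k hik hkl
    exact G.adj_symm (hcmono j l hjl hil.symm)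
  refine ⟨m, n, hpos.1, hpos.2, r, c, hr, hc, fun i j h => hrU i (h ▸ hcU j), ?_, ?_, ?_, ?_,
    hdown⟩
  · intro x
    by_cases hx : x ∈ U
    · exact Or.inr (hcof x hx)
    · exact Or.inl (hrof x hx)
  · intro x y hxy
    by_cases hx : x ∈ U
    · obtain ⟨i, rfl⟩ := hcof x hx
      obtain ⟨j, rfl⟩ := hrof y fun hy => hU _ hx _ hy hxy
      exact Or.inr ⟨i, j, rfl, rfl⟩
    · obtain ⟨i, rfl⟩ := hrof x hx
      obtain ⟨j, rfl⟩ := hcof y (by_contra fun hy => hT.not_adj_of_notMem hx hy hxy)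
      exact Or.inl ⟨i, j, rfl, rfl⟩
  · obtain ⟨i, hi⟩ := hcadj ⟨n - 1, Nat.sub_lt hpos.2 Nat.one_pos⟩
    exact hdown _ _ hi _ _ (Nat.zero_le _) le_rfl
  · obtain ⟨j, hj⟩ := hradj ⟨m - 1, Nat.sub_lt hpos.1 Nat.one_pos⟩
    exact hdown _ _ hj _ _ le_rfl (Nat.zero_le _)

/-- A connected finite simple graph on at least two vertices is Ferrers iff it is
`U`-threshold for some independent set `U`. -/
theorem stmt15 {V : Type} [Fintype V] (G : SimpleGraph V)
    (hconn : G.Connected) (hcard : 2 ≤ Fintype.card V) :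
    IsFerrers G ↔
      ∃ U : Set V, (∀ x ∈ U, ∀ y ∈ U, ¬ G.Adj x y) ∧ IsUThreshold G U := by
  have := hconn.nonempty
  have : Nontrivial V := Fintype.one_lt_card_iff_nontrivial.1 hcard
  refine ⟨IsFerrers.exists_isUThreshold, fun ⟨U, hU, hT⟩ => hT.isFerrers (fun v => ?_) hU⟩
  exact hconn.preconnected.exists_adj_of_nontrivial v
end

section
/- (Cayley–Prüfer Theorem) Let n ≥ 2, let x_1, …, x_n be real numbers, and weight each edge {v_i, v_j} of the complete graph K_n on vertices v_1, …, v_n by ω_{i,j} = x_i x_j. Then τ(K_n; ω) = (∏_{k=1}^{n} x_k) · (∑_{k=1}^{n} x_k)^(n−2). -/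
open scoped BigOperators

/-- The weighted spanning tree enumerator of `G` with edge weights `w`:
`τ(G; w) = ∑_{spanning trees T of G} ∏_{e ∈ E(T)} w(e)`. -/
noncomputable def tauW {V : Type} (G : SimpleGraph V) (w : Sym2 V → ℝ) : ℝ :=
  ∑ᶠ H ∈ {H : SimpleGraph V | H ≤ G ∧ H.IsTree}, ∏ᶠ e ∈ H.edgeSet, w e

open Finset in
/-- If no monomial of `∑ a, ∏ v, x v ^ m a v` involves every variable, then the alternating sum of
its values over all ways of setting a subset of the variables to zero vanishes. -/
theorem sum_neg_one_pow_mul_sum_prod_pow_eq_zero {V ι R : Type*} [Fintype V] [DecidableEq V]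
    [CommRing R] (s : Finset ι) (m : ι → V → ℕ) (hm : ∀ a ∈ s, ∃ v, m a v = 0) (x : V → R) :
    ∑ t : Finset V, (-1) ^ (tᶜ).card * ∑ a ∈ s, ∏ v, (if v ∈ t then x v else 0) ^ m a v = 0 := by
  simp_rw [mul_sum]
  rw [sum_comm]
  refine sum_eq_zero fun a ha => ?_
  obtain ⟨v, hv⟩ := hm a ha
  have h : ∏ u, (x u ^ m a u + -(0 : R) ^ m a u) = 0 :=
    prod_eq_zero (mem_univ v) (by simp [hv])
  refine Eq.trans ?_ h
  rw [Fintype.prod_add]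
  refine sum_congr rfl fun t _ => ?_
  rw [prod_neg, mul_left_comm, ← prod_mul_prod_compl t]
  congr 2
  · exact prod_congr rfl fun u hu => by rw [if_pos hu]
  · exact prod_congr rfl fun u hu => by rw [if_neg (mem_compl.1 hu)]

/-- Two sums of monomials, none of which involves every variable, are equal as soon as they agree
whenever some variable is zero. -/
theorem sum_prod_pow_eq_of_eq_of_exists_eq_zero {V ι κ R : Type*} [Fintype V] [DecidableEq V]
    [CommRing R] (s : Finset ι) (m : ι → V → ℕ) (hm : ∀ a ∈ s, ∃ v, m a v = 0)
    (s' : Finset κ) (m' : κ → V → ℕ) (hm' : ∀ a ∈ s', ∃ v, m' a v = 0)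
    (h : ∀ x : V → R, (∃ v, x v = 0) →
      ∑ a ∈ s, ∏ v, x v ^ m a v = ∑ a ∈ s', ∏ v, x v ^ m' a v) (x : V → R) :
    ∑ a ∈ s, ∏ v, x v ^ m a v = ∑ a ∈ s', ∏ v, x v ^ m' a v := by
  have h₁ := (sum_neg_one_pow_mul_sum_prod_pow_eq_zero s m hm x).trans
    (sum_neg_one_pow_mul_sum_prod_pow_eq_zero s' m' hm' x).symm
  iterate 2 rw [Fintype.sum_eq_add_sum_compl Finset.univ] at h₁
  rw [Finset.sum_congr rfl (g := fun t : Finset V => (-1) ^ (tᶜ).card *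
    ∑ a ∈ s', ∏ v, (if v ∈ t then x v else 0) ^ m' a v)] at h₁
  · simpa only [Finset.mem_univ, if_true, Finset.compl_univ, Finset.card_empty, pow_zero, one_mul,
      add_left_inj] using h₁
  · intro t ht
    obtain ⟨v, hv⟩ : ∃ v, v ∉ t := by
      simpa [Finset.eq_univ_iff_forall] using ht
    rw [h (fun v => if v ∈ t then x v else 0) ⟨v, if_neg hv⟩]

@[to_additive]
theorem Fintype.prod_eq_mul_prod_coe_compl_singleton {V M : Type*} [Fintype V] [DecidableEq V]
    [CommMonoid M] (f : V → M) (v : V) : ∏ u, f u = f v * ∏ u : ({v}ᶜ : Set V), f u := by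
  rw [Fintype.prod_eq_mul_prod_compl v]
  congr 1
  exact Finset.prod_subtype _ (by simp) f

namespace SimpleGraph

/-- The graph obtained from a graph on the complement of `v` by joining `v` to `w` only. -/
def attachLeaf {V : Type*} (v : V) (G : SimpleGraph ({v}ᶜ : Set V)) (w : ({v}ᶜ : Set V)) :
    SimpleGraph V :=
  G.map (Function.Embedding.subtype _) ⊔ edge v w

section AttachLeaf

variable {V : Type*} {v : V} {G : SimpleGraph ({v}ᶜ : Set V)} {w : ({v}ᶜ : Set V)}

theorem attachLeaf_adj_coe_coe (a b : ({v}ᶜ : Set V)) :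
    (attachLeaf v G w).Adj a b ↔ G.Adj a b := by
  have ha : (a : V) ≠ v := a.2
  have hb : (b : V) ≠ v := b.2
  have h : (G.map (Function.Embedding.subtype _)).Adj a b ↔ G.Adj a b := map_adj_apply
  simp only [attachLeaf, sup_adj, edge_adj, h, ha, hb, false_and, and_false, or_false]

theorem attachLeaf_adj_left (a : V) : (attachLeaf v G w).Adj v a ↔ a = w := by
  have hw : (w : V) ≠ v := w.2
  simp only [attachLeaf, sup_adj, map_adj, edge_adj]
  constructor
  · rintro (⟨a, b, -, h, -⟩ | h)
    · exact absurd h a.2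
    · grind
  · grind

theorem induce_attachLeaf : (attachLeaf v G w).induce {v}ᶜ = G := by
  ext a b
  exact attachLeaf_adj_coe_coe a b

theorem Connected.attachLeaf (hG : G.Connected) : (attachLeaf v G w).Connected := by
  let f : G →g SimpleGraph.attachLeaf v G w :=
    ⟨Subtype.val, fun {a b} h => (attachLeaf_adj_coe_coe a b).2 h⟩
  have key : ∀ a, (SimpleGraph.attachLeaf v G w).Reachable w a := by
    intro a
    by_cases ha : a = v
    · subst ha
      exact ((attachLeaf_adj_left _).2 rfl).symm.reachable
    · exact (hG.preconnected w ⟨a, ha⟩).map f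
  exact (connected_iff _).2 ⟨fun a b => (key a).symm.trans (key b), ⟨v⟩⟩

theorem IsTree.attachLeaf [Finite V] (hG : G.IsTree) : (attachLeaf v G w).IsTree := by
  classical
  have := Fintype.ofFinite V
  refine isTree_iff_connected_and_card.2 ⟨hG.connected.attachLeaf, ?_⟩
  have h := hG.card_edgeFinset
  have hw : v ≠ w := fun h => w.2 h.symm
  have hn : ¬ (G.map (Function.Embedding.subtype _)).Adj v w := by
    rintro ⟨-, a, b, -, h, -⟩
    exact a.2 h
  have h₁ := card_edgeFinset_sup_edge _ hn hw
  rw [card_edgeFinset_map] at h₁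
  rw [Nat.card_eq_fintype_card, Nat.card_eq_fintype_card, ← edgeFinset_card]
  have h₂ : Fintype.card ({v}ᶜ : Set V) = Fintype.card V - 1 := by
    rw [Fintype.card_compl_set]; simp
  have h₃ : 0 < Fintype.card V := Fintype.card_pos_iff.2 ⟨v⟩
  have h₄ : (SimpleGraph.attachLeaf v G w).edgeFinset.card = G.edgeFinset.card + 1 := by
    convert! h₁
  lia

open Classical in
theorem degree_attachLeaf_self [Fintype V] : (attachLeaf v G w).degree v = 1 :=
  degree_eq_one_iff_existsUnique_adj.2 ⟨w, (attachLeaf_adj_left _).2 rfl,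
    fun _ h => (attachLeaf_adj_left _).1 h⟩

open Classical in
theorem degree_attachLeaf_coe [Fintype V] (u : ({v}ᶜ : Set V)) :
    (attachLeaf v G w).degree u = G.degree u + if u = w then 1 else 0 := by
  have hv : v ∉ (G.neighborFinset u).map (Function.Embedding.subtype _) := by simp
  have h : (attachLeaf v G w).neighborFinset u =
      (G.neighborFinset u).map (Function.Embedding.subtype _) ∪ if u = w then {v} else ∅ := by
    ext a
    by_cases ha : a = v
    · subst ha
      rw [mem_neighborFinset, adj_comm, attachLeaf_adj_left, Finset.mem_union]
      simp only [hv, false_or, Subtype.coe_inj]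
      split_ifs with h <;> simp [h]
    · lift a to ({v}ᶜ : Set V) using ha
      have ha : (a : V) ≠ v := a.2
      rw [mem_neighborFinset, attachLeaf_adj_coe_coe, Finset.mem_union]
      split_ifs <;> simp [ha]
  rw [← card_neighborFinset_eq_degree, h, Finset.card_union_of_disjoint]
  · split_ifs <;> simp
  · split_ifs
    · exact Finset.disjoint_singleton_right.2 hv
    · exact Finset.disjoint_empty_right _

end AttachLeaf

open Classical in
/-- The sum over all trees on `V` of the monomials with exponents `deg v - 1`, evaluated at `x`. -/
noncomputable def treeSum {V : Type*} [Fintype V] (x : V → ℝ) : ℝ :=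
  ∑ T : SimpleGraph V with T.IsTree, ∏ v, x v ^ (T.degree v - 1)

open Classical in
theorem treeSum_eq_of_eq_zero {V : Type*} [Fintype V] (hV : 3 ≤ Fintype.card V) (x : V → ℝ)
    (v : V) (hv : x v = 0) :
    treeSum x = (∑ u, x u) * treeSum fun u : ({v}ᶜ : Set V) => x u := by
  have hcard : Fintype.card ({v}ᶜ : Set V) = Fintype.card V - 1 := by
    rw [Fintype.card_compl_set]; simp
  have : Nontrivial ({v}ᶜ : Set V) := Fintype.one_lt_card_iff_nontrivial.1 (by lia)
  have : Nontrivial V := Fintype.one_lt_card_iff_nontrivial.1 (by lia)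
  have hsum : ∑ u, x u = ∑ u : ({v}ᶜ : Set V), x u := by
    rw [Fintype.sum_eq_add_sum_coe_compl_singleton x v, hv, zero_add]
  have hleaf : treeSum x = ∑ T : SimpleGraph V with T.IsTree ∧ T.degree v = 1,
      ∏ u, x u ^ (T.degree u - 1) := by
    rw [treeSum, ← Finset.filter_filter]
    symm
    apply Finset.sum_filter_of_ne
    intro T hT hne
    have hpos := (Finset.mem_filter.1 hT).2.connected.preconnected.degree_pos_of_nontrivial v
    by_contra hd
    refine hne (Finset.prod_eq_zero (Finset.mem_univ v) ?_)
    rw [hv, zero_pow (by lia)]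
  rw [hleaf, hsum, treeSum, Finset.sum_mul_sum, ← Finset.sum_product']
  symm
  refine Finset.sum_bij (fun p _ => attachLeaf v p.2 p.1) ?_ ?_ ?_ ?_
  · rintro ⟨w, G⟩ h
    simp only [Finset.mem_product, Finset.mem_univ, Finset.mem_filter, true_and] at h ⊢
    exact ⟨h.attachLeaf, degree_attachLeaf_self⟩
  · rintro ⟨w, G⟩ - ⟨w', G'⟩ - h
    simp only at h
    have h₁ : G = G' := by rw [← induce_attachLeaf (G := G) (w := w), h, induce_attachLeaf]
    have h₂ : (attachLeaf v G' w').Adj v w := h ▸ (attachLeaf_adj_left _).2 rfl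
    rw [attachLeaf_adj_left, Subtype.coe_inj] at h₂
    rw [h₁, h₂]
  · intro T hT
    simp only [Finset.mem_filter, Finset.mem_univ, true_and] at hT
    obtain ⟨w, hw, hw'⟩ := degree_eq_one_iff_existsUnique_adj.1 hT.2
    refine ⟨(⟨w, hw.ne'⟩, T.induce {v}ᶜ), ?_, ?_⟩
    · simp only [Finset.mem_product, Finset.mem_univ, Finset.mem_filter, true_and]
      exact ⟨hT.1.connected.induce_compl_singleton_of_degree_eq_one hT.2, hT.1.isAcyclic.induce _⟩
    · have hl : ∀ a, (attachLeaf v (T.induce {v}ᶜ) ⟨w, hw.ne'⟩).Adj v a ↔ T.Adj v a := fun a => by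
        rw [attachLeaf_adj_left]
        exact ⟨fun h => h ▸ hw, hw' a⟩
      ext a b
      by_cases ha : a = v
      · rw [ha, hl]
      by_cases hb : b = v
      · rw [hb, adj_comm, hl, adj_comm]
      exact attachLeaf_adj_coe_coe (⟨a, ha⟩ : ({v}ᶜ : Set V)) ⟨b, hb⟩
  · rintro ⟨w, G⟩ h
    simp only [Finset.mem_product, Finset.mem_univ, Finset.mem_filter, true_and] at h ⊢
    rw [Fintype.prod_eq_mul_prod_coe_compl_singleton _ v, degree_attachLeaf_self,
      Nat.sub_self, pow_zero, one_mul]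
    have hpos (u) := h.connected.preconnected.degree_pos_of_nontrivial u
    have hexp (u : ({v}ᶜ : Set V)) : x u ^ ((attachLeaf v G w).degree u - 1) =
        (if u = w then x u else 1) * x u ^ (G.degree u - 1) := by
      rw [degree_attachLeaf_coe]
      have := hpos u
      split_ifs
      · rw [← pow_succ']
        congr 1
        lia
      · simp
    rw [Finset.prod_congr rfl fun u _ => hexp u, Finset.prod_mul_distrib]
    simp

theorem treeSum_of_card_eq_two {V : Type*} [Fintype V] (hV : Fintype.card V = 2) (x : V → ℝ) :
    treeSum x = 1 := by
  classical
  have : Nontrivial V := Fintype.one_lt_card_iff_nontrivial.1 (by lia)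
  have hdeg {T : SimpleGraph V} (hT : T.IsTree) (v : V) : T.degree v = 1 := by
    have := hT.connected.preconnected.degree_pos_of_nontrivial v
    have := T.degree_lt_card_verts v
    lia
  have hset : ({T : SimpleGraph V | T.IsTree} : Finset _) = {⊤} := by
    have hsub : ∀ T : SimpleGraph V, T.IsTree → T = ⊤ := by
      intro T hT
      refine eq_top_iff.2 fun a b hab => ?_
      have hab : a ≠ b := hab
      obtain ⟨c, hc, -⟩ := degree_eq_one_iff_existsUnique_adj.1 (hdeg hT a)
      by_contra h
      have hbc : b ≠ c := fun hbc => h (hbc ▸ hc)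
      have := Finset.card_le_univ ({a, b, c} : Finset V)
      rw [Finset.card_eq_three.2 ⟨a, b, c, hab, hc.ne, hbc, rfl⟩] at this
      lia
    have : Nonempty V := inferInstance
    obtain ⟨T, -, hT⟩ := (connected_top (V := V)).exists_isTree_le
    ext T'
    simp only [Finset.mem_filter, Finset.mem_univ, true_and, Finset.mem_singleton]
    exact ⟨hsub T', fun h => h ▸ hsub T hT ▸ hT⟩
  have htop : (⊤ : SimpleGraph V).IsTree := by
    have : (⊤ : SimpleGraph V) ∈ ({T : SimpleGraph V | T.IsTree} : Finset _) := by
      rw [hset]; exact Finset.mem_singleton_self _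
    simpa using this
  rw [treeSum, hset, Finset.sum_singleton]
  exact Finset.prod_eq_one fun v _ => by rw [hdeg htop, Nat.sub_self, pow_zero]

theorem treeSum_eq {V : Type*} [Fintype V] (hV : 2 ≤ Fintype.card V) (x : V → ℝ) :
    treeSum x = (∑ v, x v) ^ (Fintype.card V - 2) := by
  classical
  obtain ⟨k, hk⟩ : ∃ k, Fintype.card V = k + 2 := ⟨_, (Nat.sub_add_cancel hV).symm⟩
  rw [hk, Nat.add_sub_cancel]
  clear hV
  induction k generalizing V with
  | zero => rw [treeSum_of_card_eq_two hk, pow_zero]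
  | succ k ih =>
    have : Nontrivial V := Fintype.one_lt_card_iff_nontrivial.1 (by lia)
    have hpow (y : V → ℝ) : (∑ v, y v) ^ (k + 1) =
        ∑ p : Fin (k + 1) → V, ∏ v, y v ^ (Finset.univ.filter fun i => p i = v).card := by
      rw [Fintype.sum_pow]
      refine Finset.sum_congr rfl fun p _ => ?_
      rw [← Finset.prod_fiberwise' Finset.univ p y]
      simp
    rw [hpow, treeSum]
    refine sum_prod_pow_eq_of_eq_of_exists_eq_zero _ _ ?_ _ _ ?_ ?_ x
    · intro T hT
      obtain ⟨v, hv⟩ := (Finset.mem_filter.1 hT).2.exists_vert_degree_one_of_nontrivial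
      exact ⟨v, by rw [hv]⟩
    · intro p _
      have : ¬ Function.Surjective p := fun h => by
        have := Fintype.card_le_of_surjective p h
        rw [Fintype.card_fin] at this
        lia
      simpa [Function.Surjective, Finset.filter_eq_empty_iff] using this
    · rintro y ⟨v, hv⟩
      rw [← hpow, ← treeSum, treeSum_eq_of_eq_zero (by lia) y v hv, ih, pow_succ']
      · congr 2
        rw [Fintype.sum_eq_add_sum_coe_compl_singleton y v, hv, zero_add]
      · rw [Fintype.card_compl_set, hk]; simp

open Classical in
theorem prod_edgeFinset_lift_mul {V R : Type*} [Fintype V] [CommMonoid R] (G : SimpleGraph V)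
    (x : V → R) :
    ∏ e ∈ G.edgeFinset, Sym2.lift ⟨fun i j => x i * x j, fun _ _ => mul_comm _ _⟩ e =
      ∏ v, x v ^ G.degree v := by
  have h : ∀ e ∈ G.edgeFinset, Sym2.lift ⟨fun i j => x i * x j, fun _ _ => mul_comm _ _⟩ e =
      ∏ v, if v ∈ e then x v else 1 := by
    intro e he
    induction e with
    | _ a b =>
      have hab : a ≠ b := (mem_edgeFinset.1 he : G.Adj a b).ne
      rw [Sym2.lift_mk, ← Finset.prod_filter]
      have : (Finset.univ.filter fun v => v ∈ s(a, b)) = {a, b} := by ext; simp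
      rw [this, Finset.prod_pair hab]
  rw [Finset.prod_congr rfl h, Finset.prod_comm]
  refine Finset.prod_congr rfl fun v _ => ?_
  rw [← Finset.prod_filter, Finset.prod_const, ← card_incidenceFinset_eq_degree]
  congr 2
  ext e
  simp [incidenceSet]

end SimpleGraph

/-- Cayley–Prüfer Theorem: weighting each edge `{i, j}` of the complete graph on `n ≥ 2`
vertices by `xᵢ xⱼ`, the weighted spanning tree enumerator is
`(∏ₖ xₖ) · (∑ₖ xₖ)^(n-2)`. -/
theorem stmt16 (n : ℕ) (hn : 2 ≤ n) (x : Fin n → ℝ) :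
    tauW (⊤ : SimpleGraph (Fin n))
        (Sym2.lift ⟨fun i j => x i * x j, fun _ _ => mul_comm _ _⟩) =
      (∏ k, x k) * (∑ k, x k) ^ (n - 2) := by
  classical
  have : Nontrivial (Fin n) := Fin.nontrivial_iff_two_le.2 hn
  have h := SimpleGraph.treeSum_eq (V := Fin n) (by simpa using hn) x
  rw [Fintype.card_fin] at h
  rw [← h, SimpleGraph.treeSum, Finset.mul_sum, tauW,
    finsum_mem_eq_finite_toFinset_sum _ (Set.toFinite _)]
  refine Finset.sum_congr (by ext; simp) fun T hT => ?_
  have hT : T.IsTree := by simpa using hT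
  rw [← SimpleGraph.coe_edgeFinset, finprod_mem_coe_finset, SimpleGraph.prod_edgeFinset_lift_mul,
    ← Finset.prod_mul_distrib]
  refine Finset.prod_congr rfl fun v _ => ?_
  rw [← pow_succ', Nat.sub_add_cancel (hT.connected.preconnected.degree_pos_of_nontrivial v)]
end

section
/- Let G be a finite simple graph on n vertices. For an ordering v_1, …, v_n of the vertices, weight each edge {v_i, v_j} by ω_{i,j} = X_i X_j, where X_1, …, X_n are the variables of the multivariate polynomial ring ℝ[X_1, …, X_n], and let L(G; ω) be the corresponding weighted Laplacian matrix over this polynomial ring. Then G is special 2-threshold if and only if there exist an ordering v_1, …, v_n of the vertices and column vectors a, b with entries in ℝ[X_1, …, X_n] such that L(G; ω) + a bᵀ is upper triangular, where a bᵀ is the n × n outer-product matrix with (i,j) entry a_i b_j. -/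
open scoped BigOperators

/- The weighted Laplacian matrix of `G` with respect to the ordering `v`, where edge
`{v i, v j}` is weighted by `X i * X j` in `ℝ[X 0, …, X (n-1)]`. -/
open Classical in
noncomputable def lapWP {V : Type} {n : ℕ} (G : SimpleGraph V) (v : Fin n ≃ V) :
    Matrix (Fin n) (Fin n) (MvPolynomial (Fin n) ℝ) :=
  Matrix.of fun i j =>
    if i = j then
      ∑ᶠ k ∈ {k : Fin n | G.Adj (v i) (v k)}, MvPolynomial.X i * MvPolynomial.X k
    else if G.Adj (v i) (v j) then -(MvPolynomial.X i * MvPolynomial.X j) else 0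

/-- The elimination order of a `U`-threshold graph, on a finite set of vertices: every vertex of
the list outside `A` has no earlier neighbor, and every one in `A` has exactly the earlier
vertices in `U` as earlier neighbors. -/
theorem IsUThreshold.exists_list {V : Type} {G : SimpleGraph V} {U : Set V}
    (h : IsUThreshold G U) (S : Finset V) :
    ∃ (l : List V) (A : Set V), l.Nodup ∧ (∀ x, x ∈ l ↔ x ∈ S) ∧
      l.Pairwise fun y x => G.Adj x y ↔ x ∈ A ∧ y ∈ U := by
  classical
  induction S using Finset.strongInduction with
  | H S ih =>
    rcases S.eq_empty_or_nonempty with rfl | hS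
    · exact ⟨[], ∅, by simp⟩
    obtain ⟨x, hxS, hx⟩ := h S hS
    obtain ⟨l, A, hnd, hmem, hpw⟩ := ih (S.erase x) (Finset.erase_ssubset hxS)
    have hxl : x ∉ l := by simp [hmem]
    obtain ⟨c, hc⟩ : ∃ c : Prop, ∀ y ∈ l, G.Adj x y ↔ c ∧ y ∈ U := by
      rcases hx with hx | hx
      · refine ⟨False, fun y hy => ?_⟩
        obtain ⟨hyx, hyS⟩ := Finset.mem_erase.1 ((hmem y).1 hy)
        simpa [hyx, hyS] using Set.ext_iff.1 hx y
      · refine ⟨True, fun y hy => ?_⟩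
        obtain ⟨hyx, hyS⟩ := Finset.mem_erase.1 ((hmem y).1 hy)
        simpa [hyx, hyS] using Set.ext_iff.1 hx y
    refine ⟨l ++ [x], {y | y ∈ A ∧ y ≠ x ∨ y = x ∧ c}, ?_, fun y => ?_, ?_⟩
    · simpa [List.nodup_append, hnd] using fun y hy => ne_of_mem_of_not_mem hy hxl
    · by_cases hy : y = x <;> simp_all
    · refine List.pairwise_append.2 ⟨hpw.imp_of_mem fun {y z} _ hz hyz => ?_, by simp, ?_⟩
      · simp [hyz, ne_of_mem_of_not_mem hz hxl]
      · simpa using hc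

/-- Being special 2-threshold in terms of an ordering of the vertices. -/
theorem isSpecial2Threshold_iff_exists_equiv {V : Type} [Fintype V] {n : ℕ}
    (hcard : Fintype.card V = n) (G : SimpleGraph V) :
    IsSpecial2Threshold G ↔ ∃ (v : Fin n ≃ V) (A B : Set (Fin n)),
      ∀ i j : Fin n, j < i → (G.Adj (v i) (v j) ↔ i ∈ A ∧ j ∈ B) := by
  classical
  constructor
  · rintro ⟨U, hU⟩
    obtain ⟨l, A, hnd, hmem, hpw⟩ := hU.exists_list Finset.univ
    let e : Fin l.length ≃ V := hnd.getEquivOfForallMemList l (by simp [hmem])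
    obtain rfl : l.length = n := by simpa [hcard] using Fintype.card_congr e
    exact ⟨e, e ⁻¹' A, e ⁻¹' U, fun i j hji => List.pairwise_iff_get.1 hpw j i hji⟩
  · rintro ⟨v, A, B, h⟩
    refine ⟨v '' B, fun W hW => ?_⟩
    obtain ⟨i, hiW, hi⟩ := (v ⁻¹' W).toFinite.exists_maximal (hW.preimage v.surjective)
    refine ⟨v i, hiW, ?_⟩
    have hlt : ∀ j, v j ∈ W → j ≠ i → j < i := fun j hj hne =>
      lt_of_le_of_ne ((le_total j i).elim id fun hij => hi hj hij) hne
    by_cases hA : i ∈ A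
    · right
      ext y
      obtain ⟨j, rfl⟩ := v.surjective y
      by_cases hj : j = i
      · simp [hj]
      · by_cases hjW : v j ∈ W
        · simp [hjW, hj, h i j (hlt j hjW hj), hA]
        · simp [hjW]
    · left
      ext y
      obtain ⟨j, rfl⟩ := v.surjective y
      by_cases hj : j = i
      · simp [hj]
      · simpa using fun hjW => by simp [h i j (hlt j hjW hj), hA]


/-- A graph on `n` vertices is special 2-threshold iff for some ordering of its vertices
the weighted Laplacian with edge weights `Xᵢ Xⱼ` admits an upper triangular rank-one
perturbation `L + a bᵀ` over the polynomial ring `ℝ[X₁, …, Xₙ]`. -/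
theorem stmt18 {V : Type} [Fintype V] (n : ℕ) (hcard : Fintype.card V = n)
    (G : SimpleGraph V) :
    IsSpecial2Threshold G ↔
      ∃ (v : Fin n ≃ V) (a b : Fin n → MvPolynomial (Fin n) ℝ),
        ∀ i j : Fin n, j < i → lapWP G v i j + a i * b j = 0 := by
  classical
  rw [isSpecial2Threshold_iff_exists_equiv hcard]
  refine exists_congr fun v => ⟨?_, ?_⟩
  · rintro ⟨A, B, h⟩
    refine ⟨fun i => if i ∈ A then MvPolynomial.X i else 0,
      fun j => if j ∈ B then MvPolynomial.X j else 0, fun i j hji => ?_⟩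
    have hij := h i j hji
    by_cases hA : i ∈ A <;> by_cases hB : j ∈ B <;> simp_all [lapWP, hji.ne']
  · rintro ⟨a, b, h⟩
    refine ⟨{i | a i ≠ 0}, {j | b j ≠ 0}, fun i j hji => ?_⟩
    have hij := h i j hji
    simp only [lapWP, Matrix.of_apply, if_neg hji.ne'] at hij
    simp only [Set.mem_ofPred_eq, ← mul_ne_zero_iff]
    split_ifs at hij with hadj
    · simp [hadj, ← neg_add_eq_zero.1 hij]
    · simp [hadj, (zero_add _).symm.trans hij]
end
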